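/- arXiv:2401.13750 — 2 statements merged into one kernel-verified Lean document; each statement's English description precedes it below -/
import Mathlib

section
/- Let k, ℓ ≥ 1 be integers, n ≥ 1, m ∈ ℝ, and let a ∈ Σ^{-m}_{k,ℓ} be a symbol on ℝⁿ × ℝⁿ ≅ ℝ^{2n}. Let φ(Y) = e^{−|Y|²} be the Gaussian window on ℝ^{2n} and V_φ a(Z,W) = ∫_{ℝ^{2n}} a(Y) φ(Y−Z) e^{−i Y·W} dY. Define the weight ω₀(z,ζ,w,τ) = (1 + |z|^k + |ζ|^ℓ + |w|^k + |τ|^ℓ)^m. Then for every r > 0 the weighted mixed norm is finite: ∫_{ℝ^{2n}} ( sup_{Z ∈ ℝ^{2n}} |V_φ a(Z,W)| · ω₀(Z,W) )^r dW < ∞, where Z = (z,ζ) and W = (w,τ); that is, a belongs to the modulation space M^{∞,r}_{ω₀}(ℝ^{2n}). -/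
open scoped RealInnerProductSpace
open MeasureTheory

noncomputable section

/-- The coordinate direction in the phase space `ℝⁿ × ℝⁿ`. -/
def phaseDir (n : ℕ) (i : Fin n ⊕ Fin n) :
    EuclideanSpace ℝ (Fin n) × EuclideanSpace ℝ (Fin n) :=
  match i with
  | Sum.inl j => (EuclideanSpace.single j (1 : ℝ), 0)
  | Sum.inr j => (0, EuclideanSpace.single j (1 : ℝ))

/-- Iterated coordinate partial derivatives along the list of directions `L`. -/
def pderivSeq (n : ℕ) : List (Fin n ⊕ Fin n) →
    ((EuclideanSpace ℝ (Fin n) × EuclideanSpace ℝ (Fin n)) → ℂ) →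
    ((EuclideanSpace ℝ (Fin n) × EuclideanSpace ℝ (Fin n)) → ℂ)
  | [], f => f
  | (i :: L), f => fun p => fderiv ℝ (pderivSeq n L f) p (phaseDir n i)

/-- Membership in the anharmonic symbol class `Σ^m_{k,ℓ}`. -/
def SigmaClass (n k l : ℕ) (m : ℝ)
    (a : (EuclideanSpace ℝ (Fin n) × EuclideanSpace ℝ (Fin n)) → ℂ) : Prop :=
  ContDiff ℝ (⊤ : ℕ∞) a ∧
  ∀ (β α : List (Fin n)), ∃ C : ℝ, 0 < C ∧
    ∀ x ξ : EuclideanSpace ℝ (Fin n),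
      ‖pderivSeq n (β.map Sum.inl ++ α.map Sum.inr) a (x, ξ)‖ ≤
        C * (1 + ‖x‖ ^ k + ‖ξ‖ ^ l) ^ (m - (β.length : ℝ) / k - (α.length : ℝ) / l)

/-- The short-time Fourier transform on `ℝ^{2n} ≅ ℝⁿ × ℝⁿ` with respect to the Gaussian
window `φ(Y) = e^{-|Y|²}`. -/
def STFT2n (n : ℕ) (a : (EuclideanSpace ℝ (Fin n) × EuclideanSpace ℝ (Fin n)) → ℂ)
    (Z W : EuclideanSpace ℝ (Fin n) × EuclideanSpace ℝ (Fin n)) : ℂ :=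
  ∫ Y : EuclideanSpace ℝ (Fin n) × EuclideanSpace ℝ (Fin n),
    a Y * Complex.exp (-((‖Y.1 - Z.1‖ ^ 2 + ‖Y.2 - Z.2‖ ^ 2 : ℝ) : ℂ)) *
      Complex.exp (-Complex.I * ((⟪Y.1, W.1⟫ + ⟪Y.2, W.2⟫ : ℝ) : ℂ))

/-- The weight `1 + |x|^k + |ξ|^ℓ` on phase space. -/
def sigmaWeight {n : ℕ} (k l : ℕ)
    (Y : EuclideanSpace ℝ (Fin n) × EuclideanSpace ℝ (Fin n)) : ℝ :=
  1 + ‖Y.1‖ ^ k + ‖Y.2‖ ^ l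

/-- The Euclidean inner product on phase space. -/
def phaseInner {n : ℕ} (U V : EuclideanSpace ℝ (Fin n) × EuclideanSpace ℝ (Fin n)) : ℝ :=
  ⟪U.1, V.1⟫ + ⟪U.2, V.2⟫

/-- The directional derivative along `v`. -/
def dirDeriv {n : ℕ} (v : EuclideanSpace ℝ (Fin n) × EuclideanSpace ℝ (Fin n))
    (a : EuclideanSpace ℝ (Fin n) × EuclideanSpace ℝ (Fin n) → ℂ) :
    EuclideanSpace ℝ (Fin n) × EuclideanSpace ℝ (Fin n) → ℂ :=
  fun Y => fderiv ℝ a Y v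

/-- Smooth functions all of whose iterated derivatives along `v` are `O(q ^ m)`, where `q` is
the weight `sigmaWeight k l`. -/
def DirSymbol {n : ℕ} (k l : ℕ) (m : ℝ)
    (v : EuclideanSpace ℝ (Fin n) × EuclideanSpace ℝ (Fin n))
    (a : EuclideanSpace ℝ (Fin n) × EuclideanSpace ℝ (Fin n) → ℂ) : Prop :=
  ContDiff ℝ (⊤ : ℕ∞) a ∧
    ∀ j : ℕ, ∃ C : ℝ, ∀ Y, ‖(dirDeriv v)^[j] a Y‖ ≤ C * sigmaWeight k l Y ^ m

/-- A function times a polynomial in the direction `v` times the Gaussian, centred at `Z`. -/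
def gaussTerm {n : ℕ} (v : EuclideanSpace ℝ (Fin n) × EuclideanSpace ℝ (Fin n))
    (a : EuclideanSpace ℝ (Fin n) × EuclideanSpace ℝ (Fin n) → ℂ) (p : Polynomial ℝ)
    (Z Y : EuclideanSpace ℝ (Fin n) × EuclideanSpace ℝ (Fin n)) : ℂ :=
  a Y * ((p.eval (phaseInner (Y - Z) v) : ℝ) : ℂ) *
    Complex.exp (-((phaseInner (Y - Z) (Y - Z) : ℝ) : ℂ))

/-- The oscillating factor `e^{-i Y·W}`. -/
def oscTerm {n : ℕ} (W Y : EuclideanSpace ℝ (Fin n) × EuclideanSpace ℝ (Fin n)) : ℂ :=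
  Complex.exp (-Complex.I * ((phaseInner Y W : ℝ) : ℂ))

section PhaseSpace

variable {n k l : ℕ} {m : ℝ}

instance : (volume : Measure
    (EuclideanSpace ℝ (Fin n) × EuclideanSpace ℝ (Fin n))).IsAddHaarMeasure :=
  Measure.prod.instIsAddHaarMeasure _ _

theorem one_le_sigmaWeight (k l : ℕ)
    (Y : EuclideanSpace ℝ (Fin n) × EuclideanSpace ℝ (Fin n)) : 1 ≤ sigmaWeight k l Y := by
  have h1 : 0 ≤ ‖Y.1‖ ^ k := by positivity
  have h2 : 0 ≤ ‖Y.2‖ ^ l := by positivity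
  unfold sigmaWeight
  linarith

theorem sigmaWeight_pos (k l : ℕ)
    (Y : EuclideanSpace ℝ (Fin n) × EuclideanSpace ℝ (Fin n)) : 0 < sigmaWeight k l Y :=
  one_pos.trans_le (one_le_sigmaWeight k l Y)

theorem phaseInner_add_left (U V W : EuclideanSpace ℝ (Fin n) × EuclideanSpace ℝ (Fin n)) :
    phaseInner (U + V) W = phaseInner U W + phaseInner V W := by
  simp only [phaseInner, Prod.fst_add, Prod.snd_add, inner_add_left]
  ring

theorem phaseInner_smul_left (t : ℝ)
    (U V : EuclideanSpace ℝ (Fin n) × EuclideanSpace ℝ (Fin n)) :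
    phaseInner (t • U) V = t * phaseInner U V := by
  simp only [phaseInner, Prod.smul_fst, Prod.smul_snd, real_inner_smul_left]
  ring

theorem phaseInner_comm (U V : EuclideanSpace ℝ (Fin n) × EuclideanSpace ℝ (Fin n)) :
    phaseInner U V = phaseInner V U := by
  simp only [phaseInner, real_inner_comm]

theorem phaseInner_self (U : EuclideanSpace ℝ (Fin n) × EuclideanSpace ℝ (Fin n)) :
    phaseInner U U = ‖U.1‖ ^ 2 + ‖U.2‖ ^ 2 := by
  simp only [phaseInner, real_inner_self_eq_norm_sq]

theorem sq_norm_le_phaseInner_self (U : EuclideanSpace ℝ (Fin n) × EuclideanSpace ℝ (Fin n)) :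
    ‖U‖ ^ 2 ≤ phaseInner U U := by
  rw [phaseInner_self, Prod.norm_def]
  rcases max_choice ‖U.1‖ ‖U.2‖ with h | h <;> rw [h] <;>
    nlinarith [sq_nonneg ‖U.1‖, sq_nonneg ‖U.2‖]

theorem abs_phaseInner_le (U V : EuclideanSpace ℝ (Fin n) × EuclideanSpace ℝ (Fin n)) :
    |phaseInner U V| ≤ 2 * ‖V‖ * ‖U‖ := by
  have h1 : |⟪U.1, V.1⟫| ≤ ‖U‖ * ‖V‖ :=
    (abs_real_inner_le_norm _ _).trans (by gcongr; exacts [norm_fst_le U, norm_fst_le V])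
  have h2 : |⟪U.2, V.2⟫| ≤ ‖U‖ * ‖V‖ :=
    (abs_real_inner_le_norm _ _).trans (by gcongr; exacts [norm_snd_le U, norm_snd_le V])
  unfold phaseInner
  linarith [abs_add_le ⟪U.1, V.1⟫ ⟪U.2, V.2⟫]

@[fun_prop]
theorem Continuous.phaseInner {X : Type*} [TopologicalSpace X]
    {f g : X → EuclideanSpace ℝ (Fin n) × EuclideanSpace ℝ (Fin n)}
    (hf : Continuous f) (hg : Continuous g) : Continuous fun x => phaseInner (f x) (g x) := by
  unfold _root_.phaseInner
  fun_prop

theorem rpow_le_rpow_abs_mul_rpow {x y T : ℝ} (p : ℝ) (hx : 0 < x) (hy : 0 < y) (hT : 1 ≤ T)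
    (hxy : x ≤ T * y) (hyx : y ≤ T * x) : x ^ p ≤ T ^ |p| * y ^ p := by
  have hT0 : 0 < T := by linarith
  rcases le_total 0 p with hp | hp
  · rw [abs_of_nonneg hp, ← Real.mul_rpow hT0.le hy.le]
    exact Real.rpow_le_rpow hx.le hxy hp
  · have h := Real.rpow_le_rpow_of_nonpos hy hyx hp
    rw [Real.mul_rpow hT0.le hx.le] at h
    rw [abs_of_nonpos hp, Real.rpow_neg hT0.le]
    rw [← div_eq_inv_mul, le_div_iff₀ (by positivity), mul_comm]
    exact h

theorem norm_pow_le_mul {F : Type*} [SeminormedAddCommGroup F] (y z : F) {s : ℝ}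
    (h : ‖y - z‖ ≤ s) {j K : ℕ} (hj : j ≤ K) :
    ‖y‖ ^ j ≤ 2 ^ K * (1 + ‖z‖ ^ j) * (1 + s) ^ K := by
  have hs : 0 ≤ s := (norm_nonneg _).trans h
  have h1 : ‖y‖ ≤ (1 + ‖z‖) * (1 + s) := by
    have := norm_add_le (y - z) z
    rw [sub_add_cancel] at this
    nlinarith [norm_nonneg z]
  have h2 : (1 + ‖z‖) ^ j ≤ 2 ^ j * (1 + ‖z‖ ^ j) := by
    rcases le_total ‖z‖ 1 with hz | hz
    · calc (1 + ‖z‖) ^ j ≤ 2 ^ j := by gcongr; linarith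
        _ ≤ 2 ^ j * (1 + ‖z‖ ^ j) := le_mul_of_one_le_right (by positivity) (by simp)
    · calc (1 + ‖z‖) ^ j ≤ (2 * ‖z‖) ^ j := by gcongr; linarith
        _ = 2 ^ j * ‖z‖ ^ j := mul_pow _ _ _
        _ ≤ 2 ^ j * (1 + ‖z‖ ^ j) := by gcongr; linarith
  calc ‖y‖ ^ j ≤ ((1 + ‖z‖) * (1 + s)) ^ j := by gcongr
    _ = (1 + ‖z‖) ^ j * (1 + s) ^ j := mul_pow _ _ _
    _ ≤ (2 ^ j * (1 + ‖z‖ ^ j)) * (1 + s) ^ j := by gcongr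
    _ ≤ (2 ^ K * (1 + ‖z‖ ^ j)) * (1 + s) ^ K := by
      gcongr
      · norm_num
      · linarith

theorem sigmaWeight_le (k l : ℕ)
    (Y Z : EuclideanSpace ℝ (Fin n) × EuclideanSpace ℝ (Fin n)) :
    sigmaWeight k l Y ≤ 3 * 2 ^ (k + l) * (1 + ‖Y - Z‖) ^ (k + l) * sigmaWeight k l Z := by
  have h1 := norm_pow_le_mul Y.1 Z.1 (norm_fst_le (Y - Z)) (Nat.le_add_right k l)
  have h2 := norm_pow_le_mul Y.2 Z.2 (norm_snd_le (Y - Z)) (Nat.le_add_left l k)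
  have hT : (1 : ℝ) ≤ 2 ^ (k + l) * (1 + ‖Y - Z‖) ^ (k + l) :=
    one_le_mul_of_one_le_of_one_le (one_le_pow₀ (by norm_num)) (one_le_pow₀ (by simp))
  set A : ℝ := 2 ^ (k + l) * (1 + ‖Y - Z‖) ^ (k + l) with hA
  have hz1 : 0 ≤ ‖Z.1‖ ^ k := by positivity
  have hz2 : 0 ≤ ‖Z.2‖ ^ l := by positivity
  unfold sigmaWeight
  calc 1 + ‖Y.1‖ ^ k + ‖Y.2‖ ^ l
      ≤ A + A * (1 + ‖Z.1‖ ^ k) + A * (1 + ‖Z.2‖ ^ l) := by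
        rw [mul_right_comm] at h1 h2
        linarith
    _ ≤ 3 * A * (1 + ‖Z.1‖ ^ k + ‖Z.2‖ ^ l) := by
        nlinarith [mul_nonneg (zero_le_one.trans hT) hz1, mul_nonneg (zero_le_one.trans hT) hz2]
    _ = _ := by rw [hA]; ring

/-- Peetre's inequality for powers of the weight. -/
theorem exists_sigmaWeight_rpow_le (n k l : ℕ) (m : ℝ) :
    ∃ (C : ℝ) (K : ℕ), 0 ≤ C ∧
      ∀ Y Z : EuclideanSpace ℝ (Fin n) × EuclideanSpace ℝ (Fin n),
        sigmaWeight k l Y ^ m ≤ C * (1 + ‖Y - Z‖) ^ K * sigmaWeight k l Z ^ m := by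
  obtain ⟨N, hN⟩ := exists_nat_ge |m|
  refine ⟨(3 * 2 ^ (k + l)) ^ N, (k + l) * N, by positivity, fun Y Z => ?_⟩
  have hT : (1 : ℝ) ≤ 3 * 2 ^ (k + l) * (1 + ‖Y - Z‖) ^ (k + l) :=
    one_le_mul_of_one_le_of_one_le
      (one_le_mul_of_one_le_of_one_le (by norm_num) (one_le_pow₀ (by norm_num)))
      (one_le_pow₀ (by simp))
  refine (rpow_le_rpow_abs_mul_rpow m (sigmaWeight_pos k l Y) (sigmaWeight_pos k l Z) hT
    (sigmaWeight_le k l Y Z) (by simpa [norm_sub_rev] using sigmaWeight_le k l Z Y)).trans ?_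
  have := (sigmaWeight_pos k l Z).le
  gcongr
  calc _ ≤ (3 * 2 ^ (k + l) * (1 + ‖Y - Z‖) ^ (k + l)) ^ (N : ℝ) :=
        Real.rpow_le_rpow_of_exponent_le hT hN
    _ = _ := by rw [Real.rpow_natCast, mul_pow, ← pow_mul]

theorem exists_one_add_pow_mul_exp_neg_sq_le (K : ℕ) :
    ∃ C : ℝ, 0 ≤ C ∧ ∀ s : ℝ, 0 ≤ s → (1 + s) ^ K * Real.exp (-s ^ 2) ≤ C := by
  refine ⟨K.factorial * Real.exp 2, by positivity, fun s hs => ?_⟩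
  have h := Real.pow_div_factorial_le_exp (x := 1 + s) (by linarith) K
  rw [div_le_iff₀ (by positivity)] at h
  calc (1 + s) ^ K * Real.exp (-s ^ 2)
      ≤ Real.exp (1 + s) * K.factorial * Real.exp (-s ^ 2) := by gcongr
    _ = K.factorial * Real.exp (1 + s + -s ^ 2) := by rw [Real.exp_add (1 + s)]; ring
    _ ≤ _ := by gcongr; nlinarith [sq_nonneg (s - 1 / 2)]

theorem exists_abs_eval_le (p : Polynomial ℝ) (c : ℝ) (hc : 0 ≤ c) :
    ∃ (C : ℝ) (K : ℕ), 0 ≤ C ∧ ∀ s t : ℝ, 0 ≤ s → |t| ≤ c * s →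
      |p.eval t| ≤ C * (1 + s) ^ K := by
  refine ⟨∑ i ∈ Finset.range (p.natDegree + 1), |p.coeff i| * c ^ i, p.natDegree,
    by positivity, fun s t hs ht => ?_⟩
  rw [Polynomial.eval_eq_sum_range, Finset.sum_mul]
  refine (Finset.abs_sum_le_sum_abs _ _).trans (Finset.sum_le_sum fun i hi => ?_)
  rw [abs_mul, abs_pow, mul_assoc]
  gcongr
  calc |t| ^ i ≤ (c * s) ^ i := by gcongr
    _ = c ^ i * s ^ i := mul_pow _ _ _
    _ ≤ c ^ i * (1 + s) ^ i := by gcongr; linarith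
    _ ≤ c ^ i * (1 + s) ^ p.natDegree := by
      gcongr
      · linarith
      · exact Nat.lt_succ_iff.mp (Finset.mem_range.mp hi)

theorem exists_norm_gaussTerm_le
    (v : EuclideanSpace ℝ (Fin n) × EuclideanSpace ℝ (Fin n))
    {a : EuclideanSpace ℝ (Fin n) × EuclideanSpace ℝ (Fin n) → ℂ}
    (ha : DirSymbol k l m v a) (p : Polynomial ℝ) (r : ℕ) :
    ∃ C : ℝ, 0 ≤ C ∧ ∀ Z Y,
      ‖gaussTerm v a p Z Y‖ ≤ C * sigmaWeight k l Z ^ m * (1 + ‖Y - Z‖) ^ (-(r : ℝ)) := by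
  obtain ⟨Ca, hCa⟩ := ha.2 0
  obtain ⟨Cw, Kw, hCw, hw⟩ := exists_sigmaWeight_rpow_le n k l m
  obtain ⟨Cp, Kp, hCp, hp⟩ := exists_abs_eval_le p (2 * ‖v‖) (by positivity)
  obtain ⟨Ce, hCe, he⟩ := exists_one_add_pow_mul_exp_neg_sq_le (Kw + Kp + r)
  refine ⟨|Ca| * Cw * Cp * Ce, by positivity, fun Z Y => ?_⟩
  have hZ := (sigmaWeight_pos k l Z).le
  have hs := norm_nonneg (Y - Z)
  have h1 : ‖a Y‖ ≤ |Ca| * (Cw * (1 + ‖Y - Z‖) ^ Kw * sigmaWeight k l Z ^ m) :=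
    (hCa Y).trans <| mul_le_mul (le_abs_self _) (hw Y Z)
      (Real.rpow_nonneg (sigmaWeight_pos k l Y).le _) (abs_nonneg _)
  have h2 := hp ‖Y - Z‖ _ hs (abs_phaseInner_le (Y - Z) v)
  have h3 : Real.exp (-phaseInner (Y - Z) (Y - Z)) ≤ Real.exp (-‖Y - Z‖ ^ 2) :=
    Real.exp_le_exp.2 (neg_le_neg (sq_norm_le_phaseInner_self _))
  have h4 : (1 + ‖Y - Z‖) ^ (Kw + Kp) * Real.exp (-‖Y - Z‖ ^ 2) ≤
      Ce * (1 + ‖Y - Z‖) ^ (-(r : ℝ)) := by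
    rw [Real.rpow_neg (by positivity), Real.rpow_natCast, ← div_eq_mul_inv,
      le_div_iff₀ (by positivity), mul_right_comm, ← pow_add]
    exact he _ hs
  rw [gaussTerm, norm_mul, norm_mul, Complex.norm_real, Real.norm_eq_abs, ← Complex.ofReal_neg,
    Complex.norm_exp_ofReal]
  calc _ ≤ |Ca| * (Cw * (1 + ‖Y - Z‖) ^ Kw * sigmaWeight k l Z ^ m) *
        (Cp * (1 + ‖Y - Z‖) ^ Kp) * Real.exp (-‖Y - Z‖ ^ 2) := by gcongr
    _ = |Ca| * Cw * Cp * sigmaWeight k l Z ^ m *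
        ((1 + ‖Y - Z‖) ^ (Kw + Kp) * Real.exp (-‖Y - Z‖ ^ 2)) := by ring
    _ ≤ |Ca| * Cw * Cp * sigmaWeight k l Z ^ m * (Ce * (1 + ‖Y - Z‖) ^ (-(r : ℝ))) := by gcongr
    _ = _ := by ring

theorem norm_oscTerm (W Y : EuclideanSpace ℝ (Fin n) × EuclideanSpace ℝ (Fin n)) :
    ‖oscTerm W Y‖ = 1 := by
  rw [oscTerm, neg_mul, ← mul_neg, mul_comm, ← Complex.ofReal_neg]
  exact Complex.norm_exp_ofReal_mul_I _

theorem integrable_one_add_norm_sub (Z : EuclideanSpace ℝ (Fin n) × EuclideanSpace ℝ (Fin n)) :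
    Integrable fun Y : EuclideanSpace ℝ (Fin n) × EuclideanSpace ℝ (Fin n) =>
      (1 + ‖Y - Z‖) ^ (-((2 * n + 1 : ℕ) : ℝ)) := by
  have h : Integrable fun Y : EuclideanSpace ℝ (Fin n) × EuclideanSpace ℝ (Fin n) =>
      (1 + ‖Y‖) ^ (-((2 * n + 1 : ℕ) : ℝ)) := by
    apply integrable_one_add_norm
    rw [Module.finrank_prod, finrank_euclideanSpace_fin]
    exact_mod_cast (by omega : n + n < 2 * n + 1)
  exact h.comp_sub_right Z

theorem integrable_gaussTerm_mul_oscTerm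
    (v : EuclideanSpace ℝ (Fin n) × EuclideanSpace ℝ (Fin n))
    {a : EuclideanSpace ℝ (Fin n) × EuclideanSpace ℝ (Fin n) → ℂ}
    (ha : DirSymbol k l m v a) (p : Polynomial ℝ)
    (Z W : EuclideanSpace ℝ (Fin n) × EuclideanSpace ℝ (Fin n)) :
    Integrable fun Y => gaussTerm v a p Z Y * oscTerm W Y := by
  obtain ⟨C, -, hC⟩ := exists_norm_gaussTerm_le v ha p (2 * n + 1)
  refine ((integrable_one_add_norm_sub Z).const_mul (C * sigmaWeight k l Z ^ m)).mono' ?_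
    (Filter.Eventually.of_forall fun Y => ?_)
  · have := ha.1.continuous
    unfold gaussTerm oscTerm
    exact Continuous.aestronglyMeasurable (by fun_prop)
  · rw [norm_mul, norm_oscTerm, mul_one]
    exact hC Z Y

theorem exists_norm_integral_gaussTerm_le
    (v : EuclideanSpace ℝ (Fin n) × EuclideanSpace ℝ (Fin n))
    {a : EuclideanSpace ℝ (Fin n) × EuclideanSpace ℝ (Fin n) → ℂ}
    (ha : DirSymbol k l m v a) (p : Polynomial ℝ) :
    ∃ C : ℝ, ∀ Z W,
      ‖∫ Y, gaussTerm v a p Z Y * oscTerm W Y‖ ≤ C * sigmaWeight k l Z ^ m := by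
  obtain ⟨C, -, hC⟩ := exists_norm_gaussTerm_le v ha p (2 * n + 1)
  refine ⟨C * ∫ Y : EuclideanSpace ℝ (Fin n) × EuclideanSpace ℝ (Fin n),
    (1 + ‖Y‖) ^ (-((2 * n + 1 : ℕ) : ℝ)), fun Z W => ?_⟩
  calc _ ≤ ∫ Y, C * sigmaWeight k l Z ^ m * (1 + ‖Y - Z‖) ^ (-((2 * n + 1 : ℕ) : ℝ)) := by
        refine norm_integral_le_of_norm_le ((integrable_one_add_norm_sub Z).const_mul _)
          (Filter.Eventually.of_forall fun Y => ?_)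
        rw [norm_mul, norm_oscTerm, mul_one]
        exact hC Z Y
    _ = _ := by
      rw [integral_const_mul, integral_sub_right_eq_self
        (fun Y : EuclideanSpace ℝ (Fin n) × EuclideanSpace ℝ (Fin n) =>
          (1 + ‖Y‖) ^ (-((2 * n + 1 : ℕ) : ℝ))) Z]
      ring

theorem DirSymbol.dirDeriv {v : EuclideanSpace ℝ (Fin n) × EuclideanSpace ℝ (Fin n)}
    {a : EuclideanSpace ℝ (Fin n) × EuclideanSpace ℝ (Fin n) → ℂ}
    (ha : DirSymbol k l m v a) : DirSymbol k l m v (dirDeriv v a) :=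
  ⟨(ha.1.fderiv_right (m := ((⊤ : ℕ∞) : WithTop ℕ∞)) (by simp)).clm_apply contDiff_const,
    fun j => by
    obtain ⟨C, hC⟩ := ha.2 (j + 1)
    exact ⟨C, fun Y => by simpa only [Function.iterate_succ_apply] using hC Y⟩⟩

open Polynomial in
theorem hasLineDerivAt_gaussTerm {v : EuclideanSpace ℝ (Fin n) × EuclideanSpace ℝ (Fin n)}
    {a : EuclideanSpace ℝ (Fin n) × EuclideanSpace ℝ (Fin n) → ℂ}
    (ha : Differentiable ℝ a) (p : Polynomial ℝ)
    (Z Y : EuclideanSpace ℝ (Fin n) × EuclideanSpace ℝ (Fin n)) :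
    HasLineDerivAt ℝ (gaussTerm v a p Z)
      (gaussTerm v (dirDeriv v a) p Z Y +
        gaussTerm v a (C (phaseInner v v) * derivative p - C 2 * X * p) Z Y) Y v := by
  have h1 : HasDerivAt (fun t : ℝ => a (Y + t • v)) (dirDeriv v a Y) 0 :=
    (ha Y).hasFDerivAt.hasLineDerivAt v
  have h2 : HasDerivAt
      (fun t : ℝ => ((p.eval (phaseInner (Y - Z) v + t * phaseInner v v) : ℝ) : ℂ))
      (((derivative p).eval (phaseInner (Y - Z) v) * phaseInner v v : ℝ) : ℂ) 0 := by
    apply HasDerivAt.ofReal_comp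
    have h := (p.hasDerivAt (phaseInner (Y - Z) v + 0 * phaseInner v v)).comp (0 : ℝ)
      (((hasDerivAt_id (0 : ℝ)).mul_const (phaseInner v v)).const_add (phaseInner (Y - Z) v))
    simpa [Function.comp_def] using h
  have h3 : HasDerivAt
      (fun t : ℝ => Complex.exp (-((phaseInner (Y - Z) (Y - Z) + t * (2 * phaseInner (Y - Z) v) +
        t ^ 2 * phaseInner v v : ℝ) : ℂ)))
      (Complex.exp (-((phaseInner (Y - Z) (Y - Z) : ℝ) : ℂ)) *
        (-((2 * phaseInner (Y - Z) v : ℝ) : ℂ))) 0 := by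
    have h : HasDerivAt (fun t : ℝ => phaseInner (Y - Z) (Y - Z) +
        t * (2 * phaseInner (Y - Z) v) + t ^ 2 * phaseInner v v) (2 * phaseInner (Y - Z) v) 0 := by
      simpa using (((hasDerivAt_id (0 : ℝ)).mul_const (2 * phaseInner (Y - Z) v)).const_add
        (phaseInner (Y - Z) (Y - Z))).fun_add ((hasDerivAt_pow 2 (0 : ℝ)).mul_const (phaseInner v v))
    simpa using h.ofReal_comp.fun_neg.cexp
  have h := (h1.fun_mul h2).fun_mul h3
  unfold HasLineDerivAt
  refine (h.congr_deriv ?_).congr_of_eventuallyEq (Filter.Eventually.of_forall fun t => ?_)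
  rotate_left
  · have e : Y + t • v - Z = (Y - Z) + t • v := by abel
    simp only [gaussTerm, e]
    congr 5
    · rw [phaseInner_add_left, phaseInner_smul_left]
    · rw [phaseInner_add_left, phaseInner_smul_left, phaseInner_comm _ (Y - Z + t • v),
        phaseInner_comm v, phaseInner_add_left, phaseInner_smul_left, phaseInner_add_left,
        phaseInner_smul_left, phaseInner_comm v (Y - Z)]
      ring
  · simp [gaussTerm]
    ring

theorem hasLineDerivAt_oscTerm (v W Y : EuclideanSpace ℝ (Fin n) × EuclideanSpace ℝ (Fin n)) :
    HasLineDerivAt ℝ (oscTerm W) (-Complex.I * (phaseInner v W : ℂ) * oscTerm W Y) Y v := by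
  have h : HasDerivAt (fun t : ℝ => phaseInner Y W + t * phaseInner v W) (phaseInner v W) 0 := by
    simpa using ((hasDerivAt_id (0 : ℝ)).mul_const (phaseInner v W)).const_add (phaseInner Y W)
  have h' := (h.ofReal_comp.const_mul (-Complex.I)).cexp
  unfold HasLineDerivAt
  refine (h'.congr_deriv ?_).congr_of_eventuallyEq (Filter.Eventually.of_forall fun t => ?_)
  rotate_left
  · simp only [oscTerm, phaseInner_add_left, phaseInner_smul_left]
  · simp [oscTerm]
    ring

open Polynomial in
theorem phaseInner_mul_integral_gaussTerm
    {v : EuclideanSpace ℝ (Fin n) × EuclideanSpace ℝ (Fin n)}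
    {a : EuclideanSpace ℝ (Fin n) × EuclideanSpace ℝ (Fin n) → ℂ}
    (ha : DirSymbol k l m v a) (p : Polynomial ℝ)
    (Z W : EuclideanSpace ℝ (Fin n) × EuclideanSpace ℝ (Fin n)) :
    Complex.I * (phaseInner v W : ℂ) * ∫ Y, gaussTerm v a p Z Y * oscTerm W Y =
      (∫ Y, gaussTerm v (dirDeriv v a) p Z Y * oscTerm W Y) +
        ∫ Y, gaussTerm v a (C (phaseInner v v) * derivative p - C 2 * X * p) Z Y *
          oscTerm W Y := by
  have i0 := integrable_gaussTerm_mul_oscTerm v ha p Z W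
  have i1 := integrable_gaussTerm_mul_oscTerm v ha.dirDeriv p Z W
  have i2 := integrable_gaussTerm_mul_oscTerm v ha
    (C (phaseInner v v) * derivative p - C 2 * X * p) Z W
  have h := integral_bilinear_hasLineDerivAt_right_eq_neg_left_of_integrable (μ := volume)
    (B := ContinuousLinearMap.mul ℝ ℂ) (f := gaussTerm v a p Z) (g := oscTerm W) (v := v)
    (f' := fun Y => gaussTerm v (_root_.dirDeriv v a) p Z Y +
        gaussTerm v a (C (phaseInner v v) * derivative p - C 2 * X * p) Z Y)
    (g' := fun Y => -Complex.I * (phaseInner v W : ℂ) * oscTerm W Y)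
    (by simpa only [ContinuousLinearMap.mul_apply', add_mul] using i1.fun_add i2)
    (by simpa only [ContinuousLinearMap.mul_apply', mul_left_comm] using
      i0.const_mul (-Complex.I * (phaseInner v W : ℂ)))
    (by simpa only [ContinuousLinearMap.mul_apply'] using i0)
    (fun Y _ => hasLineDerivAt_gaussTerm (ha.1.differentiable (by simp)) p Z Y)
    (fun Y _ => hasLineDerivAt_oscTerm v W Y)
  simp only [ContinuousLinearMap.mul_apply', add_mul] at h
  rw [integral_add i1 i2] at h
  simp only [mul_left_comm (gaussTerm v a p Z _)] at h
  rw [integral_const_mul, neg_mul, neg_mul, neg_inj] at h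
  exact h

theorem exists_abs_phaseInner_pow_mul_norm_integral_le
    (v : EuclideanSpace ℝ (Fin n) × EuclideanSpace ℝ (Fin n)) (N : ℕ) :
    ∀ {a : EuclideanSpace ℝ (Fin n) × EuclideanSpace ℝ (Fin n) → ℂ},
      DirSymbol k l m v a → ∀ p : Polynomial ℝ, ∃ C : ℝ, ∀ Z W,
        |phaseInner v W| ^ N * ‖∫ Y, gaussTerm v a p Z Y * oscTerm W Y‖ ≤
          C * sigmaWeight k l Z ^ m := by
  induction N with
  | zero =>
    intro a ha p
    simpa using exists_norm_integral_gaussTerm_le v ha p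
  | succ N ih =>
    intro a ha p
    obtain ⟨C₁, h₁⟩ := ih ha.dirDeriv p
    obtain ⟨C₂, h₂⟩ := ih ha (.C (phaseInner v v) * p.derivative - .C 2 * .X * p)
    refine ⟨C₁ + C₂, fun Z W => ?_⟩
    have h := congrArg norm (phaseInner_mul_integral_gaussTerm ha p Z W)
    rw [norm_mul, norm_mul, Complex.norm_I, one_mul, Complex.norm_real, Real.norm_eq_abs] at h
    rw [pow_succ, mul_assoc, h, add_mul]
    refine le_trans ?_ (add_le_add (h₁ Z W) (h₂ Z W))
    rw [← mul_add]
    gcongr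
    exact norm_add_le _ _

theorem STFT2n_eq_integral_gaussTerm
    (v : EuclideanSpace ℝ (Fin n) × EuclideanSpace ℝ (Fin n))
    (a : EuclideanSpace ℝ (Fin n) × EuclideanSpace ℝ (Fin n) → ℂ)
    (Z W : EuclideanSpace ℝ (Fin n) × EuclideanSpace ℝ (Fin n)) :
    STFT2n n a Z W = ∫ Y, gaussTerm v a 1 Z Y * oscTerm W Y := by
  simp only [STFT2n, gaussTerm, oscTerm, phaseInner_self, Prod.fst_sub, Prod.snd_sub,
    Polynomial.eval_one, Complex.ofReal_one, mul_one]
  rfl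

theorem SigmaClass.dirSymbol
    {a : EuclideanSpace ℝ (Fin n) × EuclideanSpace ℝ (Fin n) → ℂ}
    (ha : SigmaClass n k l m a) (i : Fin n ⊕ Fin n) : DirSymbol k l m (phaseDir n i) a := by
  have key : ∀ j, (dirDeriv (phaseDir n i))^[j] a = pderivSeq n (List.replicate j i) a := by
    intro j
    induction j with
    | zero => rfl
    | succ j ih => rw [Function.iterate_succ_apply', ih]; rfl
  refine ⟨ha.1, fun j => ?_⟩
  obtain ⟨β, α, hL⟩ : ∃ β α : List (Fin n),
      List.replicate j i = β.map Sum.inl ++ α.map Sum.inr := by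
    rcases i with c | c
    · exact ⟨List.replicate j c, [], by simp⟩
    · exact ⟨[], List.replicate j c, by simp⟩
  obtain ⟨C, hC, h⟩ := ha.2 β α
  refine ⟨C, fun Y => ?_⟩
  rw [key, hL]
  refine (h Y.1 Y.2).trans ?_
  gcongr
  refine Real.rpow_le_rpow_of_exponent_le (one_le_sigmaWeight k l Y) ?_
  have h1 : (0 : ℝ) ≤ (β.length : ℝ) / k := by positivity
  have h2 : (0 : ℝ) ≤ (α.length : ℝ) / l := by positivity
  linarith

theorem norm_le_sum_abs_phaseInner (W : EuclideanSpace ℝ (Fin n) × EuclideanSpace ℝ (Fin n)) :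
    ‖W‖ ≤ ∑ i, |phaseInner (phaseDir n i) W| := by
  have key : ∀ x : EuclideanSpace ℝ (Fin n), ‖x‖ ≤ ∑ j, |x j| := fun x => by
    conv_lhs => rw [← (EuclideanSpace.basisFun (Fin n) ℝ).sum_repr x]
    refine (norm_sum_le _ _).trans (Finset.sum_le_sum fun j _ => ?_)
    simp [norm_smul]
  have h1 := key W.1
  have h2 := key W.2
  have h1' := Finset.sum_nonneg fun j (_ : j ∈ Finset.univ) => abs_nonneg (W.1 j)
  have h2' := Finset.sum_nonneg fun j (_ : j ∈ Finset.univ) => abs_nonneg (W.2 j)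
  rw [Fintype.sum_sum_type]
  simp only [phaseInner, phaseDir, EuclideanSpace.inner_single_left, inner_zero_left, map_one,
    one_mul, add_zero, zero_add]
  exact max_le (by linarith) (by linarith)

/-- The short-time Fourier transform of a symbol decays rapidly in `W`, uniformly in `Z` up to
the weight. -/
theorem SigmaClass.exists_norm_STFT2n_le
    {a : EuclideanSpace ℝ (Fin n) × EuclideanSpace ℝ (Fin n) → ℂ}
    (ha : SigmaClass n k l m a) (hn : 1 ≤ n) (N : ℕ) :
    ∃ C : ℝ, 0 ≤ C ∧ ∀ Z W,
      (1 + ‖W‖) ^ N * ‖STFT2n n a Z W‖ ≤ C * sigmaWeight k l Z ^ m := by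
  choose c hc using fun i : Fin n ⊕ Fin n =>
    exists_abs_phaseInner_pow_mul_norm_integral_le (phaseDir n i) (N + 1) (ha.dirSymbol i) 1
  obtain ⟨c₀, hc₀⟩ := exists_norm_integral_gaussTerm_le _ (ha.dirSymbol (Sum.inl ⟨0, hn⟩)) 1
  simp only [← STFT2n_eq_integral_gaussTerm] at hc hc₀
  obtain ⟨D, hD⟩ : ∃ D : ℝ, D = ((Finset.univ : Finset (Fin n ⊕ Fin n)).card : ℝ) := ⟨_, rfl⟩
  refine ⟨|2 ^ (N + 1) * (c₀ + D ^ N * ∑ i, c i)|, abs_nonneg _, fun Z W => ?_⟩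
  have hW : (1 + ‖W‖) ^ N ≤
      2 ^ (N + 1) * (1 + D ^ N * ∑ i, |phaseInner (phaseDir n i) W| ^ (N + 1)) := by
    have h1 : (1 + ‖W‖) ^ N ≤ (1 + ‖W‖) ^ (N + 1) := pow_le_pow_right₀ (by simp) (by simp)
    have h2 : (1 + ‖W‖) ^ (N + 1) ≤ 2 ^ N * (1 + ‖W‖ ^ (N + 1)) := by
      simpa using add_pow_le zero_le_one (norm_nonneg W) (N + 1)
    have h3 : ‖W‖ ^ (N + 1) ≤ D ^ N * ∑ i, |phaseInner (phaseDir n i) W| ^ (N + 1) :=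
      (pow_le_pow_left₀ (norm_nonneg W) (norm_le_sum_abs_phaseInner W) _).trans
        (by
          simpa [hD] using pow_sum_le_card_mul_sum_pow (s := Finset.univ)
            (fun i _ => abs_nonneg (phaseInner (phaseDir n i) W)) N)
    refine h1.trans (h2.trans ?_)
    gcongr
    · norm_num
    · simp
  have hq : 0 ≤ sigmaWeight k l Z ^ m := Real.rpow_nonneg (sigmaWeight_pos k l Z).le _
  calc _ ≤ 2 ^ (N + 1) * (1 + D ^ N * ∑ i, |phaseInner (phaseDir n i) W| ^ (N + 1)) *
        ‖STFT2n n a Z W‖ := by gcongr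
    _ = 2 ^ (N + 1) * (‖STFT2n n a Z W‖ +
        D ^ N * ∑ i, |phaseInner (phaseDir n i) W| ^ (N + 1) * ‖STFT2n n a Z W‖) := by
      rw [← Finset.sum_mul]; ring
    _ ≤ 2 ^ (N + 1) * (c₀ * sigmaWeight k l Z ^ m + D ^ N * ∑ i, c i * sigmaWeight k l Z ^ m) := by
      refine mul_le_mul_of_nonneg_left (add_le_add (hc₀ Z W) (mul_le_mul_of_nonneg_left
        (Finset.sum_le_sum fun i _ => hc i Z W) ?_)) (by positivity)
      rw [hD]
      positivity
    _ = 2 ^ (N + 1) * (c₀ + D ^ N * ∑ i, c i) * sigmaWeight k l Z ^ m := by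
      rw [← Finset.sum_mul]; ring
    _ ≤ _ := by gcongr; exact le_abs_self _

theorem exists_phaseWeight_rpow_le (n k l : ℕ) (m : ℝ) :
    ∃ (C : ℝ) (K : ℕ), 0 ≤ C ∧
      ∀ Z W : EuclideanSpace ℝ (Fin n) × EuclideanSpace ℝ (Fin n),
        (1 + ‖Z.1‖ ^ k + ‖Z.2‖ ^ l + ‖W.1‖ ^ k + ‖W.2‖ ^ l) ^ m ≤
          C * (1 + ‖W‖) ^ K * sigmaWeight k l Z ^ m := by
  obtain ⟨C, K, hC, h⟩ := exists_sigmaWeight_rpow_le n k l |m|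
  refine ⟨C * sigmaWeight k l (0 : EuclideanSpace ℝ (Fin n) × EuclideanSpace ℝ (Fin n)) ^ |m|, K,
    mul_nonneg hC (Real.rpow_nonneg (sigmaWeight_pos k l _).le _), fun Z W => ?_⟩
  have hZ := one_le_sigmaWeight k l Z
  have hW := one_le_sigmaWeight k l W
  have hZW : 1 + ‖Z.1‖ ^ k + ‖Z.2‖ ^ l + ‖W.1‖ ^ k + ‖W.2‖ ^ l =
      sigmaWeight k l Z + sigmaWeight k l W - 1 := by
    unfold sigmaWeight
    ring
  rw [hZW]
  refine (rpow_le_rpow_abs_mul_rpow (y := sigmaWeight k l Z) m (by linarith) (by linarith) hW (by nlinarith)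
    (by nlinarith)).trans ?_
  have := h W 0
  rw [sub_zero, mul_right_comm] at this
  gcongr

end PhaseSpace

/-- If `a ∈ Σ^{-m}_{k,ℓ}` then `a` belongs to the modulation space `M^{∞,r}_{ω₀}(ℝ^{2n})`
for every `r > 0`, where `ω₀(z,ζ,w,τ) = (1+|z|^k+|ζ|^ℓ+|w|^k+|τ|^ℓ)^m`; i.e. the weighted
mixed norm `∫ (sup_Z |V_φ a(Z,W)| ω₀(Z,W))^r dW` is finite. -/
theorem symbol_in_modulation_space (k l n : ℕ) (m : ℝ) (hk : 1 ≤ k) (hl : 1 ≤ l)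
    (hn : 1 ≤ n)
    (a : (EuclideanSpace ℝ (Fin n) × EuclideanSpace ℝ (Fin n)) → ℂ)
    (ha : SigmaClass n k l (-m) a) :
    ∀ r : ℝ, 0 < r →
      (∫⁻ W : EuclideanSpace ℝ (Fin n) × EuclideanSpace ℝ (Fin n),
        ENNReal.ofReal
          ((⨆ Z : EuclideanSpace ℝ (Fin n) × EuclideanSpace ℝ (Fin n),
              ‖STFT2n n a Z W‖ *
                (1 + ‖Z.1‖ ^ k + ‖Z.2‖ ^ l + ‖W.1‖ ^ k + ‖W.2‖ ^ l) ^ m) ^ r)) < ⊤ := by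
  intro r hr
  obtain ⟨C₁, K, hC₁, hω⟩ := exists_phaseWeight_rpow_le n k l m
  obtain ⟨s, hs⟩ := exists_nat_gt ((n + n : ℕ) / r : ℝ)
  obtain ⟨C₂, hC₂, hV⟩ := ha.exists_norm_STFT2n_le hn (K + s)
  have hsr : ((Module.finrank ℝ (EuclideanSpace ℝ (Fin n) × EuclideanSpace ℝ (Fin n)) : ℕ) : ℝ) <
      s * r := by
    rw [Module.finrank_prod, finrank_euclideanSpace_fin]
    exact (div_lt_iff₀ hr).1 hs
  have hbound : ∀ W : EuclideanSpace ℝ (Fin n) × EuclideanSpace ℝ (Fin n),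
      (⨆ Z : EuclideanSpace ℝ (Fin n) × EuclideanSpace ℝ (Fin n),
        ‖STFT2n n a Z W‖ *
          (1 + ‖Z.1‖ ^ k + ‖Z.2‖ ^ l + ‖W.1‖ ^ k + ‖W.2‖ ^ l) ^ m) ≤
        C₁ * C₂ * (1 + ‖W‖) ^ (-(s : ℝ)) := by
    intro W
    refine Real.iSup_le (fun Z => ?_) (by positivity)
    have hZ := sigmaWeight_pos k l Z
    have hcancel : sigmaWeight k l Z ^ (-m) * sigmaWeight k l Z ^ m = 1 := by
      rw [← Real.rpow_add hZ, neg_add_cancel, Real.rpow_zero]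
    rw [Real.rpow_neg (by positivity), Real.rpow_natCast, ← div_eq_mul_inv,
      le_div_iff₀ (by positivity)]
    calc _ ≤ ‖STFT2n n a Z W‖ * (C₁ * (1 + ‖W‖) ^ K * sigmaWeight k l Z ^ m) *
          (1 + ‖W‖) ^ s := by
          gcongr
          exact hω Z W
      _ = C₁ * ((1 + ‖W‖) ^ (K + s) * ‖STFT2n n a Z W‖) * sigmaWeight k l Z ^ m := by ring
      _ ≤ C₁ * (C₂ * sigmaWeight k l Z ^ (-m)) * sigmaWeight k l Z ^ m := by
          exact mul_le_mul_of_nonneg_right (mul_le_mul_of_nonneg_left (hV Z W) hC₁)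
            (by positivity)
      _ = C₁ * C₂ * (sigmaWeight k l Z ^ (-m) * sigmaWeight k l Z ^ m) := by ring
      _ = C₁ * C₂ := by rw [hcancel, mul_one]
  calc _ ≤ ∫⁻ W : EuclideanSpace ℝ (Fin n) × EuclideanSpace ℝ (Fin n),
        ENNReal.ofReal ((C₁ * C₂) ^ r) * ENNReal.ofReal ((1 + ‖W‖) ^ (-(s * r))) := by
        refine lintegral_mono fun W => ?_
        rw [← ENNReal.ofReal_mul (by positivity)]
        refine ENNReal.ofReal_le_ofReal ((Real.rpow_le_rpow (Real.iSup_nonneg fun Z => by positivity)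
          (hbound W) hr.le).trans_eq ?_)
        rw [Real.mul_rpow (by positivity) (by positivity), ← Real.rpow_mul (by positivity),
          neg_mul]
    _ = ENNReal.ofReal ((C₁ * C₂) ^ r) *
        ∫⁻ W : EuclideanSpace ℝ (Fin n) × EuclideanSpace ℝ (Fin n),
          ENNReal.ofReal ((1 + ‖W‖) ^ (-(s * r))) :=
        lintegral_const_mul' _ _ ENNReal.ofReal_ne_top
    _ < ⊤ := ENNReal.mul_lt_top ENNReal.ofReal_lt_top (finite_integral_one_add_norm hsr)
end
end

section
/- Let m ∈ ℝ, let k, ℓ ≥ 1 be integers, n ≥ 1, 0 < p, q ≤ ∞, and let a ∈ Σ^{-m}_{k,ℓ}. For u in the Schwartz space 𝒮(ℝⁿ), define the Kohn–Nirenberg quantization a(x,D)u(x) = (2π)^{-n} ∫_{ℝⁿ} e^{i x·ξ} a(x,ξ) û(ξ) dξ, where û(ξ) = ∫_{ℝⁿ} e^{−i y·ξ} u(y) dy (this integral converges absolutely since û is Schwartz and a is polynomially bounded). Then there exists a constant C > 0 such that for all u ∈ 𝒮(ℝⁿ): ‖a(x,D)u‖_{M^{p,q}_{v^m}} ≤ C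 ‖u‖_{M^{p,q}}, where v(x,ξ) = 1 + |x|^k + |ξ|^ℓ. -/
open scoped RealInnerProductSpace ENNReal
open MeasureTheory

noncomputable section

/-- Short-time Fourier transform on `ℝⁿ` with Gaussian window `φ(y) = e^{-|y|²}`:
`V_φ f (x,ξ) = ∫ f(y) φ(y-x) e^{-i y·ξ} dy`. -/
def STFT (n : ℕ) (f : EuclideanSpace ℝ (Fin n) → ℂ) (x ξ : EuclideanSpace ℝ (Fin n)) : ℂ :=
  ∫ y : EuclideanSpace ℝ (Fin n),
    f y * Complex.exp (-((‖y - x‖ ^ 2 : ℝ) : ℂ)) * Complex.exp (-Complex.I * (⟪y, ξ⟫ : ℝ))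

/-- The `L^p` "norm" (`0 < p ≤ ∞`) of an `ℝ≥0∞`-valued function, with the usual
essential-supremum convention for `p = ∞`. -/
def eLp {α : Type*} [MeasurableSpace α] (p : ℝ≥0∞) (μ : Measure α) (f : α → ℝ≥0∞) : ℝ≥0∞ :=
  if p = ∞ then essSup f μ else (∫⁻ a, f a ^ p.toReal ∂μ) ^ (1 / p.toReal)

/-- The weighted modulation quasi-norm `‖f‖_{M^{p,q}_w}`, computed with the Gaussian
window: first an `L^p` norm in `x`, then an `L^q` norm in `ξ`. -/
def modNorm (n : ℕ) (p q : ℝ≥0∞) (w : EuclideanSpace ℝ (Fin n) → EuclideanSpace ℝ (Fin n) → ℝ)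
    (f : EuclideanSpace ℝ (Fin n) → ℂ) : ℝ≥0∞ :=
  eLp q volume (fun ξ =>
    eLp p volume (fun x => ENNReal.ofReal (‖STFT n f x ξ‖ * w x ξ)))

/-- The Fourier transform `û(ξ) = ∫ e^{-i y·ξ} u(y) dy`. -/
def FT (n : ℕ) (u : EuclideanSpace ℝ (Fin n) → ℂ) (ξ : EuclideanSpace ℝ (Fin n)) : ℂ :=
  ∫ y : EuclideanSpace ℝ (Fin n), u y * Complex.exp (-Complex.I * (⟪y, ξ⟫ : ℝ))

/-- The Kohn–Nirenberg quantization
`a(x,D)u(x) = (2π)^{-n} ∫ e^{i x·ξ} a(x,ξ) û(ξ) dξ`. -/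
def KNQuant (n : ℕ) (a : (EuclideanSpace ℝ (Fin n) × EuclideanSpace ℝ (Fin n)) → ℂ)
    (u : EuclideanSpace ℝ (Fin n) → ℂ) (x : EuclideanSpace ℝ (Fin n)) : ℂ :=
  ((2 * Real.pi) ^ n : ℝ)⁻¹ •
    ∫ ξ : EuclideanSpace ℝ (Fin n),
      Complex.exp (Complex.I * (⟪x, ξ⟫ : ℝ)) * a (x, ξ) * FT n u ξ

section DerivativeBounds

variable {V W : Type*} [NormedAddCommGroup V] [NormedSpace ℝ V] [NormedAddCommGroup W]
  [NormedSpace ℝ W]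

/-- The iterated real derivatives of the complex exponential are bounded by its modulus. -/
theorem norm_iteratedFDeriv_cexp_le (i : ℕ) (w : ℂ) :
    ‖iteratedFDeriv ℝ i Complex.exp w‖ ≤ ‖Complex.exp w‖ := by
  induction i with
  | zero => simp
  | succ i ih =>
    have hd : fderiv ℝ Complex.exp = fun z => ContinuousLinearMap.mul ℝ ℂ (Complex.exp z) := by
      funext z
      have h := ((Complex.hasDerivAt_exp z).hasFDerivAt.restrictScalars ℝ).fderiv
      rw [h]
      ext x
      simp [mul_comm]
    rw [← norm_iteratedFDeriv_fderiv, hd]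
    have h1 := (ContinuousLinearMap.mul ℝ ℂ).norm_iteratedFDeriv_comp_left (f := Complex.exp)
      (x := w) (N := i) (n := i) (Complex.contDiff_exp.contDiffAt) le_rfl
    refine h1.trans ?_
    calc _ ≤ 1 * ‖iteratedFDeriv ℝ i Complex.exp w‖ := by
          gcongr
          exact ContinuousLinearMap.opNorm_mul_le ℝ ℂ
      _ ≤ _ := by simpa using ih

/-- Gaussian decay beats polynomial growth. -/
theorem exists_pow_mul_exp_neg_sq_le (s : ℝ) :
    ∃ C : ℝ, 0 < C ∧ ∀ t : ℝ, 0 ≤ t → Real.exp (-t ^ 2) ≤ C * (1 + t) ^ (-s) := by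
  obtain ⟨M, hM⟩ := exists_nat_ge s
  refine ⟨Real.exp (M ^ 2), Real.exp_pos _, fun t ht => ?_⟩
  have h1 : (1 + t) ^ s ≤ (1 + t) ^ (M : ℝ) := Real.rpow_le_rpow_of_exponent_le (by linarith) hM
  have h2 : (1 + t) ^ (M : ℝ) ≤ Real.exp (M * t) := by
    rw [Real.rpow_natCast, Real.exp_nat_mul]
    gcongr
    linarith [Real.add_one_le_exp t]
  rw [Real.rpow_neg (by linarith), ← div_eq_mul_inv, le_div_iff₀ (by positivity)]
  calc Real.exp (-t ^ 2) * (1 + t) ^ s ≤ Real.exp (-t ^ 2) * Real.exp (M * t) := by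
        gcongr; exact h1.trans h2
    _ = Real.exp (-t ^ 2 + M * t) := by rw [Real.exp_add]
    _ ≤ _ := by
        apply Real.exp_le_exp.2
        nlinarith [sq_nonneg (t - M), sq_nonneg t]

/-- The exponential of a phase function whose real part is at most `-‖z‖²` is rapidly decreasing
together with all its derivatives. -/
theorem exists_norm_iteratedFDeriv_cexp_comp_le {Q : V → ℂ} (hQ : Q.HasTemperateGrowth)
    (hre : ∀ z, (Q z).re ≤ -‖z‖ ^ 2) (j : ℕ) (s : ℝ) :
    ∃ C : ℝ, 0 < C ∧ ∀ z, ‖iteratedFDeriv ℝ j (fun z => Complex.exp (Q z)) z‖ ≤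
      C * (1 + ‖z‖) ^ (-s) := by
  obtain ⟨k, C, hC, hb⟩ := hQ.norm_iteratedFDeriv_le_uniform j
  obtain ⟨C', hC', hb'⟩ := exists_pow_mul_exp_neg_sq_le (s + k * j)
  refine ⟨j.factorial * C' * (1 + C) ^ j, by positivity, fun z => ?_⟩
  have h1 : (1 : ℝ) ≤ (1 + C) * (1 + ‖z‖) ^ k :=
    one_le_mul_of_one_le_of_one_le (by linarith) (one_le_pow₀ (by linarith [norm_nonneg z]))
  have h := norm_iteratedFDeriv_comp_le (𝕜 := ℝ) (g := Complex.exp) (f := Q) (n := j) (N := j)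
    Complex.contDiff_exp (hQ.1.of_le (by exact_mod_cast le_top)) le_rfl z
    (C := Real.exp (-‖z‖ ^ 2)) (D := (1 + C) * (1 + ‖z‖) ^ k)
    (fun i _ => (norm_iteratedFDeriv_cexp_le i _).trans (by
      rw [Complex.norm_exp]; exact Real.exp_le_exp.2 (hre z)))
    (fun i hi hij => (hb i hij z).trans (by
      calc C * (1 + ‖z‖) ^ k ≤ (1 + C) * (1 + ‖z‖) ^ k := by gcongr; linarith
        _ ≤ _ := le_self_pow₀ h1 (by omega)))
  refine h.trans ?_
  have h2 := hb' ‖z‖ (norm_nonneg _)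
  have hz : 0 < 1 + ‖z‖ := by positivity
  calc _ ≤ j.factorial * (C' * (1 + ‖z‖) ^ (-(s + k * j))) * ((1 + C) * (1 + ‖z‖) ^ k) ^ j := by
        gcongr
    _ = j.factorial * C' * (1 + C) ^ j * ((1 + ‖z‖) ^ (-(s + k * j)) * (1 + ‖z‖) ^ (k * j)) := by
        rw [mul_pow, ← pow_mul]; ring
    _ = _ := by
        rw [← Real.rpow_natCast (1 + ‖z‖), ← Real.rpow_add hz]
        push_cast; ring_nf

/-- Integration by parts: quantitative decay of an oscillatory integral. -/
theorem pow_mul_norm_integral_mul_cexp_le [FiniteDimensional ℝ V] [MeasurableSpace V]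
    [BorelSpace V] {μ : Measure V} [μ.IsAddHaarMeasure] (L : V →L[ℝ] W →L[ℝ] ℝ) {N : ℕ}
    {f : V → ℂ} (hf : ContDiff ℝ N f) {B : ℝ} {h : V → ℝ} (hh : Integrable h μ)
    (hB : ∀ j ≤ N, ∀ x, ‖iteratedFDeriv ℝ j f x‖ ≤ B * h x) (v : V) (hv : ‖v‖ ≤ 1) (w : W) :
    |L v w| ^ N * ‖∫ x, f x * Complex.exp (-Complex.I * (L x w : ℝ)) ∂μ‖ ≤
      (4 * Real.pi) ^ N * (N + 1) * (B * ∫ x, h x ∂μ) := by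
  have hint : ∀ j ≤ N, Integrable (fun x => ‖iteratedFDeriv ℝ j f x‖) μ := fun j hj =>
    (hh.const_mul B).mono'
      (hf.continuous_iteratedFDeriv (by exact_mod_cast hj)).norm.aestronglyMeasurable
      (.of_forall fun x => by simpa using hB j hj x)
  have key := VectorFourier.pow_mul_norm_iteratedFDeriv_fourierIntegral_le L (μ := μ) (K := 0)
    (N := N) (f := f) (by exact_mod_cast hf) (by
      intro k j hk hj
      obtain rfl : k = 0 := by simpa using hk
      simpa using hint j (by exact_mod_cast hj)) (k := 0) (n := N) (by simp) le_rfl v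
      ((2 * Real.pi)⁻¹ • w)
  have hF : VectorFourier.fourierIntegral Real.fourierChar μ L.toLinearMap₁₂ f
      ((2 * Real.pi)⁻¹ • w) = ∫ x, f x * Complex.exp (-Complex.I * (L x w : ℝ)) ∂μ := by
    simp only [VectorFourier.fourierIntegral]
    congr 1; funext x
    rw [Circle.smul_def, Real.fourierChar_apply, smul_eq_mul, mul_comm]
    congr 2
    simp
    field_simp
  rw [norm_iteratedFDeriv_zero, hF] at key
  have hpi := Real.pi_pos
  have h2 : |L v ((2 * Real.pi)⁻¹ • w)| ^ N = ((2 * Real.pi) ^ N)⁻¹ * |L v w| ^ N := by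
    rw [map_smul, smul_eq_mul, abs_mul, mul_pow, abs_of_pos (by positivity), inv_pow]
  rw [h2, mul_assoc, inv_mul_le_iff₀ (by positivity)] at key
  refine key.trans ?_
  have hsum : ∑ p ∈ Finset.range (0 + 1) ×ˢ Finset.range (N + 1),
      ∫ x, ‖x‖ ^ p.1 * ‖iteratedFDeriv ℝ p.2 f x‖ ∂μ ≤ (N + 1) * (B * ∫ x, h x ∂μ) := by
    rw [Finset.sum_product]
    simp only [zero_add, Finset.range_one, Finset.sum_singleton, pow_zero, one_mul]
    refine (Finset.sum_le_card_nsmul _ _ (B * ∫ x, h x ∂μ) fun j hj => ?_).trans_eq (by simp)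
    rw [← integral_const_mul]
    have hj' : j ≤ N := by simpa [Nat.lt_succ_iff] using hj
    exact integral_mono (hint j hj') (hh.const_mul B) (hB j hj')
  have hsum0 : 0 ≤ ∑ p ∈ Finset.range (0 + 1) ×ˢ Finset.range (N + 1),
      ∫ x, ‖x‖ ^ p.1 * ‖iteratedFDeriv ℝ p.2 f x‖ ∂μ :=
    Finset.sum_nonneg fun p _ => integral_nonneg fun x => by positivity
  calc _ ≤ (2 * Real.pi) ^ N * (1 * 1 * 2 ^ N * ((N + 1) * (B * ∫ x, h x ∂μ))) := by
        gcongr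
        · exact pow_le_one₀ (norm_nonneg _) hv
        · simp
        · simp
    _ = _ := by
        rw [show (4 : ℝ) * Real.pi = 2 * Real.pi * 2 by ring, mul_pow _ (2 : ℝ)]; ring

end DerivativeBounds

section UniformBounds

variable {V W : Type*} [NormedAddCommGroup V] [NormedSpace ℝ V] [NormedAddCommGroup W]
  [NormedSpace ℝ W]

/-- Finitely many bounds can be made uniform. -/
theorem exists_forall_le_mul_of_forall_exists {α : Type*} {g : ℕ → α → ℝ} {h : α → ℝ}
    (hh : ∀ x, 0 ≤ h x) (H : ∀ j, ∃ C : ℝ, 0 < C ∧ ∀ x, g j x ≤ C * h x) (N : ℕ) :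
    ∃ C : ℝ, 0 < C ∧ ∀ j ≤ N, ∀ x, g j x ≤ C * h x := by
  choose C hC hb using H
  refine ⟨∑ j ∈ Finset.range (N + 1), C j, Finset.sum_pos (fun j _ => hC j) (by simp),
    fun j hj x => (hb j x).trans ?_⟩
  exact mul_le_mul_of_nonneg_right
    (Finset.single_le_sum (f := C) (fun i _ => (hC i).le) (by simpa [Nat.lt_succ_iff] using hj))
    (hh x)

theorem norm_iteratedFDeriv_mul_le_two_pow {f g : V → ℂ} {j : ℕ} (hf : ContDiff ℝ j f)
    (hg : ContDiff ℝ j g) {A B : ℝ} {z : V} (hA : ∀ i ≤ j, ‖iteratedFDeriv ℝ i f z‖ ≤ A)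
    (hB : ∀ i ≤ j, ‖iteratedFDeriv ℝ i g z‖ ≤ B) :
    ‖iteratedFDeriv ℝ j (fun y => f y * g y) z‖ ≤ 2 ^ j * (A * B) := by
  refine (norm_iteratedFDeriv_mul_le hf hg z le_rfl).trans ?_
  have hA0 : 0 ≤ A := (norm_nonneg _).trans (hA 0 (Nat.zero_le _))
  have h2 : ((2 : ℝ) ^ j) = ∑ i ∈ Finset.range (j + 1), (j.choose i : ℝ) := by
    exact_mod_cast (Nat.sum_range_choose j).symm
  rw [h2, Finset.sum_mul]
  refine Finset.sum_le_sum fun i hi => ?_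
  rw [mul_assoc]
  have := hA i (by simpa [Nat.lt_succ_iff] using hi)
  have := hB (j - i) (Nat.sub_le _ _)
  gcongr

/-- Decay of an oscillatory integral in the frequency variable. -/
theorem norm_integral_mul_cexp_le_rpow [FiniteDimensional ℝ V] [MeasurableSpace V]
    [BorelSpace V] {μ : Measure V} [μ.IsAddHaarMeasure] (L : V →L[ℝ] W →L[ℝ] ℝ) {N : ℕ}
    {f : V → ℂ} (hf : ContDiff ℝ N f) {B : ℝ} {h : V → ℝ} (hh : Integrable h μ)
    (hB : ∀ j ≤ N, ∀ x, ‖iteratedFDeriv ℝ j f x‖ ≤ B * h x) {s : ℝ} (hs : s ≤ N) (w : W)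
    (hw : ∃ v, ‖v‖ ≤ 1 ∧ |L v w| = ‖w‖) :
    ‖∫ x, f x * Complex.exp (-Complex.I * (L x w : ℝ)) ∂μ‖ ≤
      2 ^ N * (1 + (4 * Real.pi) ^ N * (N + 1)) * (B * ∫ x, h x ∂μ) * (1 + ‖w‖) ^ (-s) := by
  obtain ⟨v, hv, hvw⟩ := hw
  have h1 := pow_mul_norm_integral_mul_cexp_le L hf hh hB v hv w
  have h0 := pow_mul_norm_integral_mul_cexp_le L (N := 0) (hf.of_le (by simp)) hh
    (fun j hj x => hB j (hj.trans (Nat.zero_le _)) x) v hv w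
  simp only [pow_zero, one_mul, Nat.cast_zero, zero_add] at h0
  rw [hvw] at h1
  set I := ‖∫ x, f x * Complex.exp (-Complex.I * (L x w : ℝ)) ∂μ‖
  set K := B * ∫ x, h x ∂μ
  have hw1 : 1 ≤ 1 + ‖w‖ := by linarith [norm_nonneg w]
  rw [Real.rpow_neg (by positivity), ← div_eq_mul_inv, le_div_iff₀ (by positivity)]
  have hI : 0 ≤ I := norm_nonneg _
  calc I * (1 + ‖w‖) ^ s ≤ I * (1 + ‖w‖) ^ (N : ℝ) := by gcongr
    _ = I * (1 + ‖w‖) ^ N := by rw [Real.rpow_natCast]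
    _ ≤ I * (2 ^ N * (1 ^ N + ‖w‖ ^ N)) := by
        gcongr
        refine (add_pow_le zero_le_one (norm_nonneg w) N).trans ?_
        gcongr
        · norm_num
        · omega
    _ = 2 ^ N * (I + ‖w‖ ^ N * I) := by rw [one_pow]; ring
    _ ≤ 2 ^ N * (K + (4 * Real.pi) ^ N * (N + 1) * K) := by gcongr
    _ = _ := by ring

end UniformBounds

section PhaseWeight

variable {E : Type*} [NormedAddCommGroup E]

/-- The product Japanese bracket on phase space. -/
def phaseWeight (z : E × E) : ℝ := (1 + ‖z.1‖) * (1 + ‖z.2‖)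

theorem one_le_phaseWeight (z : E × E) : 1 ≤ phaseWeight z :=
  one_le_mul_of_one_le_of_one_le (by linarith [norm_nonneg z.1]) (by linarith [norm_nonneg z.2])

theorem phaseWeight_pos (z : E × E) : 0 < phaseWeight z :=
  one_pos.trans_le (one_le_phaseWeight z)

theorem one_add_norm_add_le (x y : E) : 1 + ‖x + y‖ ≤ (1 + ‖x‖) * (1 + ‖y‖) := by
  nlinarith [norm_add_le x y, norm_nonneg x, norm_nonneg y,
    mul_nonneg (norm_nonneg x) (norm_nonneg y)]

theorem phaseWeight_add_le (z w : E × E) :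
    phaseWeight (z + w) ≤ phaseWeight z * phaseWeight w := by
  calc phaseWeight (z + w) ≤ ((1 + ‖z.1‖) * (1 + ‖w.1‖)) * ((1 + ‖z.2‖) * (1 + ‖w.2‖)) :=
        mul_le_mul (one_add_norm_add_le _ _) (one_add_norm_add_le _ _) (by positivity)
          (by positivity)
    _ = _ := by simp only [phaseWeight]; ring

theorem phaseWeight_neg (z : E × E) : phaseWeight (-z) = phaseWeight z := by
  simp [phaseWeight]

theorem phaseWeight_le_sq (z : E × E) : phaseWeight z ≤ (1 + ‖z‖) ^ 2 := by
  rw [sq]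
  exact mul_le_mul (by linarith [norm_fst_le z]) (by linarith [norm_snd_le z]) (by positivity)
    (by positivity)

theorem one_add_norm_rpow_le_phaseWeight {s : ℝ} (hs : 0 ≤ s) (z : E × E) :
    (1 + ‖z‖) ^ (-(2 * s)) ≤ phaseWeight z ^ (-s) := by
  have h : (0 : ℝ) ≤ 1 + ‖z‖ := by positivity
  rw [show -(2 * s) = 2 * (-s) by ring, Real.rpow_mul h]
  refine Real.rpow_le_rpow_of_nonpos (phaseWeight_pos z) ?_ (by linarith)
  simpa using phaseWeight_le_sq z

theorem phaseWeight_rpow_mul_le {s : ℝ} (hs : 0 ≤ s) (z w : E × E) :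
    phaseWeight z ^ (-s) * phaseWeight w ^ (-s) ≤ phaseWeight (z + w) ^ (-s) := by
  rw [← Real.mul_rpow (phaseWeight_pos z).le (phaseWeight_pos w).le]
  exact Real.rpow_le_rpow_of_nonpos (phaseWeight_pos _) (phaseWeight_add_le z w) (by linarith)

theorem phaseWeight_rpow_le_one {s : ℝ} (hs : 0 ≤ s) (z : E × E) : phaseWeight z ^ (-s) ≤ 1 :=
  Real.rpow_le_one_of_one_le_of_nonpos (one_le_phaseWeight z) (by linarith)

theorem phaseWeight_rpow (z : E × E) (s : ℝ) :
    phaseWeight z ^ s = (1 + ‖z.1‖) ^ s * (1 + ‖z.2‖) ^ s :=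
  Real.mul_rpow (by positivity) (by positivity)

theorem continuous_phaseWeight_rpow (s : ℝ) : Continuous fun z : E × E => phaseWeight z ^ s := by
  refine Continuous.rpow_const ?_ fun z => .inl (phaseWeight_pos z).ne'
  unfold phaseWeight
  fun_prop

theorem integrable_phaseWeight_rpow [NormedSpace ℝ E] [FiniteDimensional ℝ E] [MeasurableSpace E]
    [BorelSpace E] {μ : Measure E} [μ.IsAddHaarMeasure] {s : ℝ} (hs : Module.finrank ℝ E < s) :
    Integrable (fun z : E × E => phaseWeight z ^ (-s)) (μ.prod μ) := by
  simp_rw [phaseWeight_rpow]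
  exact (integrable_one_add_norm hs).mul_prod (integrable_one_add_norm hs)

/-- The anharmonic weight `1 + |x|^k + |ξ|^l`. -/
def anharmonicWeight (k l : ℕ) (z : E × E) : ℝ := 1 + ‖z.1‖ ^ k + ‖z.2‖ ^ l

theorem one_le_anharmonicWeight (k l : ℕ) (z : E × E) : 1 ≤ anharmonicWeight k l z := by
  have : 0 ≤ ‖z.1‖ ^ k := by positivity
  have : 0 ≤ ‖z.2‖ ^ l := by positivity
  unfold anharmonicWeight; linarith

theorem anharmonicWeight_pos (k l : ℕ) (z : E × E) : 0 < anharmonicWeight k l z :=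
  one_pos.trans_le (one_le_anharmonicWeight k l z)

theorem norm_add_pow_le (k : ℕ) (x y : E) :
    ‖x + y‖ ^ k ≤ 2 ^ k * (1 + ‖x‖ ^ k) * (1 + ‖y‖) ^ k := by
  calc ‖x + y‖ ^ k ≤ ((1 + ‖x‖) * (1 + ‖y‖)) ^ k := by
        gcongr; linarith [one_add_norm_add_le x y]
    _ = (1 + ‖x‖) ^ k * (1 + ‖y‖) ^ k := mul_pow _ _ _
    _ ≤ _ := by
        gcongr
        refine (add_pow_le zero_le_one (norm_nonneg x) k).trans ?_
        rw [one_pow]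
        gcongr
        · norm_num
        · omega

theorem anharmonicWeight_add_le (k l : ℕ) (z w : E × E) :
    anharmonicWeight k l (z + w) ≤
      3 * 2 ^ (k + l) * (anharmonicWeight k l z * phaseWeight w ^ (k + l)) := by
  have hv := one_le_anharmonicWeight k l z
  have hJ := one_le_phaseWeight w
  have hv1 : 1 + ‖z.1‖ ^ k ≤ anharmonicWeight k l z := by
    have : 0 ≤ ‖z.2‖ ^ l := by positivity
    unfold anharmonicWeight; linarith
  have hv2 : 1 + ‖z.2‖ ^ l ≤ anharmonicWeight k l z := by
    have : 0 ≤ ‖z.1‖ ^ k := by positivity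
    unfold anharmonicWeight; linarith
  have hJ1 : 1 + ‖w.1‖ ≤ phaseWeight w :=
    le_mul_of_one_le_right (by positivity) (by linarith [norm_nonneg w.2])
  have hJ2 : 1 + ‖w.2‖ ≤ phaseWeight w :=
    le_mul_of_one_le_left (by positivity) (by linarith [norm_nonneg w.1])
  set T := 2 ^ (k + l) * (anharmonicWeight k l z * phaseWeight w ^ (k + l)) with hT
  have h1 : 1 ≤ T := one_le_mul_of_one_le_of_one_le (one_le_pow₀ (by norm_num))
    (one_le_mul_of_one_le_of_one_le hv (one_le_pow₀ hJ))
  have h2 : ‖z.1 + w.1‖ ^ k ≤ T := by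
    refine (norm_add_pow_le k _ _).trans ?_
    rw [hT, mul_assoc]
    gcongr
    · norm_num
    · omega
    · calc (1 + ‖w.1‖) ^ k ≤ phaseWeight w ^ k := by gcongr
        _ ≤ _ := pow_le_pow_right₀ hJ (by omega)
  have h3 : ‖z.2 + w.2‖ ^ l ≤ T := by
    refine (norm_add_pow_le l _ _).trans ?_
    rw [hT, mul_assoc]
    gcongr
    · norm_num
    · omega
    · calc (1 + ‖w.2‖) ^ l ≤ phaseWeight w ^ l := by gcongr
        _ ≤ _ := pow_le_pow_right₀ hJ (by omega)
  calc anharmonicWeight k l (z + w) = 1 + ‖z.1 + w.1‖ ^ k + ‖z.2 + w.2‖ ^ l := rfl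
    _ ≤ T + T + T := by gcongr
    _ = _ := by rw [hT]; ring

/-- All real powers of the anharmonic weight are moderate. -/
theorem exists_anharmonicWeight_rpow_add_le (k l : ℕ) (m : ℝ) :
    ∃ C : ℝ, 0 < C ∧ ∃ s : ℝ, 0 ≤ s ∧ ∀ z w : E × E,
      anharmonicWeight k l (z + w) ^ m ≤ C * anharmonicWeight k l z ^ m * phaseWeight w ^ s := by
  refine ⟨(3 * 2 ^ (k + l)) ^ |m|, by positivity, ((k + l : ℕ) : ℝ) * |m|, by positivity,
    fun z w => ?_⟩
  have hz := anharmonicWeight_pos k l z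
  have hzw := anharmonicWeight_pos k l (z + w)
  have hw := phaseWeight_pos w
  have e : (3 * 2 ^ (k + l) : ℝ) ^ |m| * anharmonicWeight k l z ^ m *
      phaseWeight w ^ (((k + l : ℕ) : ℝ) * |m|) =
      anharmonicWeight k l z ^ m * (3 * 2 ^ (k + l) * phaseWeight w ^ (k + l)) ^ |m| := by
    rw [Real.mul_rpow (x := 3 * 2 ^ (k + l)) (by positivity) (by positivity),
      Real.rpow_mul hw.le, Real.rpow_natCast]
    ring
  rw [e]
  rcases le_total 0 m with hm | hm
  · rw [abs_of_nonneg hm, ← Real.mul_rpow hz.le (by positivity)]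
    refine Real.rpow_le_rpow hzw.le ((anharmonicWeight_add_le k l z w).trans_eq ?_) hm
    ring
  · rw [abs_of_nonpos hm, Real.rpow_neg (by positivity), ← div_eq_mul_inv,
      ← Real.div_rpow hz.le (by positivity)]
    refine Real.rpow_le_rpow_of_nonpos (by positivity) ?_ hm
    rw [div_le_iff₀ (by positivity)]
    have := anharmonicWeight_add_le k l (z + w) (-w)
    rw [add_neg_cancel_right, phaseWeight_neg] at this
    refine this.trans_eq ?_
    ring

end PhaseWeight

section Symbols

variable {n : ℕ} {a : (EuclideanSpace ℝ (Fin n) × EuclideanSpace ℝ (Fin n)) → ℂ}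

theorem contDiff_pderivSeq (ha : ContDiff ℝ (⊤ : ℕ∞) a) (L : List (Fin n ⊕ Fin n)) :
    ContDiff ℝ (⊤ : ℕ∞) (pderivSeq n L a) := by
  induction L with
  | nil => exact ha
  | cons i L ih =>
    exact (ih.fderiv_right (m := (⊤ : ℕ∞)) (by simp)).clm_apply contDiff_const

theorem pderivSeq_swap (ha : ContDiff ℝ (⊤ : ℕ∞) a) (i j : Fin n ⊕ Fin n)
    (L : List (Fin n ⊕ Fin n)) :
    pderivSeq n (i :: j :: L) a = pderivSeq n (j :: i :: L) a := by
  funext p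
  have hf := contDiff_pderivSeq ha L
  have hd : DifferentiableAt ℝ (fderiv ℝ (pderivSeq n L a)) p :=
    ((hf.fderiv_right (m := (⊤ : ℕ∞)) (by simp)).differentiable (by simp)).differentiableAt
  have hsymm : IsSymmSndFDerivAt ℝ (pderivSeq n L a) p :=
    hf.contDiffAt.isSymmSndFDerivAt (by
      rw [minSmoothness_of_isRCLikeNormedField]
      exact WithTop.coe_le_coe.2 (le_top : (2 : ℕ∞) ≤ ⊤))
  have key : ∀ i j : Fin n ⊕ Fin n, pderivSeq n (i :: j :: L) a p =
      fderiv ℝ (fderiv ℝ (pderivSeq n L a)) p (phaseDir n i) (phaseDir n j) := by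
    intro i j
    simp only [pderivSeq]
    rw [fderiv_clm_apply hd (differentiableAt_const _)]
    simp
  rw [key, key]
  exact hsymm _ _

theorem pderivSeq_perm (ha : ContDiff ℝ (⊤ : ℕ∞) a) {L L' : List (Fin n ⊕ Fin n)}
    (h : L.Perm L') : pderivSeq n L a = pderivSeq n L' a := by
  induction h with
  | nil => rfl
  | cons i _ ih => simp only [pderivSeq, ih]
  | swap i j L => exact pderivSeq_swap ha j i L
  | trans _ _ ih₁ ih₂ => exact ih₁.trans ih₂

theorem exists_perm_map_inl_append_map_inr {α β : Type*} (L : List (α ⊕ β)) :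
    ∃ (l₁ : List α) (l₂ : List β), L.Perm (l₁.map Sum.inl ++ l₂.map Sum.inr) := by
  induction L with
  | nil => exact ⟨[], [], by simp⟩
  | cons i L ih =>
    obtain ⟨l₁, l₂, h⟩ := ih
    rcases i with i | i
    · exact ⟨i :: l₁, l₂, by simpa using h⟩
    · refine ⟨l₁, i :: l₂, (h.cons _).trans ?_⟩
      simpa using List.perm_middle.symm

theorem SigmaClass.exists_norm_pderivSeq_le {k l : ℕ} {m : ℝ} (ha : SigmaClass n k l m a)
    (L : List (Fin n ⊕ Fin n)) :
    ∃ C : ℝ, 0 < C ∧ ∀ z, ‖pderivSeq n L a z‖ ≤ C * anharmonicWeight k l z ^ m := by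
  obtain ⟨β, α, h⟩ := exists_perm_map_inl_append_map_inr L
  obtain ⟨C, hC, hb⟩ := ha.2 β α
  refine ⟨C, hC, fun z => ?_⟩
  rw [pderivSeq_perm ha.1 h]
  refine (hb z.1 z.2).trans ?_
  change C * anharmonicWeight k l z ^ _ ≤ _
  have h1 : 0 ≤ (β.length : ℝ) / k := by positivity
  have h2 : 0 ≤ (α.length : ℝ) / l := by positivity
  gcongr
  · exact one_le_anharmonicWeight k l z
  · linarith

/-- The coordinate functional dual to `phaseDir`. -/
def phaseCoord (n : ℕ) (i : Fin n ⊕ Fin n) :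
    (EuclideanSpace ℝ (Fin n) × EuclideanSpace ℝ (Fin n)) →L[ℝ] ℝ :=
  match i with
  | Sum.inl j => (EuclideanSpace.proj j).comp (ContinuousLinearMap.fst ℝ _ _)
  | Sum.inr j => (EuclideanSpace.proj j).comp (ContinuousLinearMap.snd ℝ _ _)

theorem sum_phaseCoord_smul_phaseDir
    (z : EuclideanSpace ℝ (Fin n) × EuclideanSpace ℝ (Fin n)) :
    ∑ i, phaseCoord n i z • phaseDir n i = z := by
  have h : ∀ x : EuclideanSpace ℝ (Fin n), ∑ j, x j • EuclideanSpace.single j (1 : ℝ) = x := by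
    intro x
    ext i
    simp [Finset.sum_apply, Pi.single_apply]
  rw [Fintype.sum_sum_type]
  ext1
  · simp [phaseCoord, phaseDir, Prod.fst_sum, h]
  · simp [phaseCoord, phaseDir, Prod.snd_sum, h]

theorem exists_fderiv_pderivSeq_eq_sum (n : ℕ) :
    ∃ T : Fin n ⊕ Fin n →
        ℂ →L[ℝ] ((EuclideanSpace ℝ (Fin n) × EuclideanSpace ℝ (Fin n)) →L[ℝ] ℂ),
      ∀ a L, fderiv ℝ (pderivSeq n L a) = fun z => ∑ i, T i (pderivSeq n (i :: L) a z) := by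
  refine ⟨fun i => ContinuousLinearMap.smulRightL ℝ _ ℂ (phaseCoord n i), fun a L => ?_⟩
  funext z
  refine ContinuousLinearMap.ext fun w => ?_
  conv_lhs => rw [← sum_phaseCoord_smul_phaseDir w]
  rw [map_sum]
  simp [pderivSeq]

/-- All derivatives of a symbol are controlled by the weight itself. -/
theorem SigmaClass.exists_norm_iteratedFDeriv_le {k l : ℕ} {m : ℝ} (ha : SigmaClass n k l m a)
    (j : ℕ) :
    ∃ C : ℝ, 0 < C ∧ ∀ z, ‖iteratedFDeriv ℝ j a z‖ ≤ C * anharmonicWeight k l z ^ m := by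
  suffices H : ∀ L : List (Fin n ⊕ Fin n), ∃ C : ℝ, 0 < C ∧
      ∀ z, ‖iteratedFDeriv ℝ j (pderivSeq n L a) z‖ ≤ C * anharmonicWeight k l z ^ m from H []
  obtain ⟨T, hT⟩ := exists_fderiv_pderivSeq_eq_sum n
  induction j with
  | zero => simpa using ha.exists_norm_pderivSeq_le
  | succ j ih =>
    intro L
    choose C hC hb using fun i => ih (i :: L)
    refine ⟨1 + ∑ i, ‖T i‖ * C i, by
      have : 0 ≤ ∑ i, ‖T i‖ * C i :=
        Finset.sum_nonneg fun i _ => mul_nonneg (norm_nonneg (T i)) (hC i).le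
      linarith, fun z => ?_⟩
    have hsm : ∀ i, ContDiff ℝ j (pderivSeq n (i :: L) a) := fun i =>
      (contDiff_pderivSeq ha.1 _).of_le (by exact_mod_cast le_top)
    have hv := Real.rpow_nonneg (anharmonicWeight_pos k l z).le m
    have hsum := iteratedFDeriv_fun_sum_apply (𝕜 := ℝ) (u := Finset.univ) (n := j) (x := z)
      (f := fun i z => T i (pderivSeq n (i :: L) a z))
      fun i _ => ((T i).contDiff.comp (hsm i)).contDiffAt
    rw [← norm_iteratedFDeriv_fderiv, hT, hsum]
    refine (norm_sum_le _ _).trans ?_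
    rw [add_mul, one_mul, Finset.sum_mul]
    refine le_add_of_nonneg_of_le hv (Finset.sum_le_sum fun i _ => ?_)
    refine ((T i).norm_iteratedFDeriv_comp_left (hsm i).contDiffAt le_rfl).trans ?_
    rw [mul_assoc]
    exact mul_le_mul_of_nonneg_left (hb i z) (norm_nonneg _)

end Symbols

section ShortTimeFourier

variable {n : ℕ}

theorem SchwartzMap.exists_norm_iteratedFDeriv_le {V : Type*} [NormedAddCommGroup V]
    [NormedSpace ℝ V] (u : SchwartzMap V ℂ) (j : ℕ) (s : ℝ) :
    ∃ C : ℝ, 0 < C ∧ ∀ x, ‖iteratedFDeriv ℝ j u x‖ ≤ C * (1 + ‖x‖) ^ (-s) := by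
  obtain ⟨M, hM⟩ := exists_nat_ge s
  set S := 2 ^ M * ((Finset.Iic (M, j)).sup fun m => SchwartzMap.seminorm ℝ m.1 m.2) u
  have hS : 0 ≤ S := by positivity
  refine ⟨S + 1, by linarith, fun x => ?_⟩
  have h := SchwartzMap.one_add_le_sup_seminorm_apply (𝕜 := ℝ) (m := (M, j)) (k := M) (n := j)
    le_rfl le_rfl u x
  have hx : 1 ≤ 1 + ‖x‖ := by linarith [norm_nonneg x]
  rw [Real.rpow_neg (by positivity), ← div_eq_mul_inv, le_div_iff₀ (by positivity)]
  calc _ ≤ ‖iteratedFDeriv ℝ j u x‖ * (1 + ‖x‖) ^ (M : ℝ) := by gcongr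
    _ = (1 + ‖x‖) ^ M * ‖iteratedFDeriv ℝ j u x‖ := by rw [Real.rpow_natCast, mul_comm]
    _ ≤ S := h
    _ ≤ S + 1 := by linarith

theorem exists_norm_iteratedFDeriv_gaussian_le {V : Type*} [NormedAddCommGroup V]
    [InnerProductSpace ℝ V] (j : ℕ) (s : ℝ) :
    ∃ C : ℝ, 0 < C ∧ ∀ x : V,
      ‖iteratedFDeriv ℝ j (fun x : V => Complex.exp (-((‖x‖ ^ 2 : ℝ) : ℂ))) x‖ ≤
        C * (1 + ‖x‖) ^ (-s) :=
  exists_norm_iteratedFDeriv_cexp_comp_le (Q := fun x : V => -((‖x‖ ^ 2 : ℝ) : ℂ)) (by fun_prop)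
    (fun z => by rw [Complex.neg_re, Complex.ofReal_re]) j s

theorem contDiff_gaussian {V : Type*} [NormedAddCommGroup V] [InnerProductSpace ℝ V]
    {N : WithTop ℕ∞} : ContDiff ℝ N (fun x : V => Complex.exp (-((‖x‖ ^ 2 : ℝ) : ℂ))) :=
  Complex.contDiff_exp.comp (Complex.ofRealCLM.contDiff.comp (contDiff_norm_sq ℝ)).neg

theorem exists_norm_eq_abs_inner {V : Type*} [NormedAddCommGroup V] [InnerProductSpace ℝ V]
    (w : V) : ∃ v : V, ‖v‖ ≤ 1 ∧ |⟪v, w⟫| = ‖w‖ := by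
  rcases eq_or_ne w 0 with rfl | hw
  · exact ⟨0, by simp, by simp⟩
  · have hw' : ‖w‖ ≠ 0 := norm_ne_zero_iff.2 hw
    refine ⟨‖w‖⁻¹ • w, by simp [norm_smul, hw'], ?_⟩
    rw [real_inner_smul_left, real_inner_self_eq_norm_sq, sq, inv_mul_cancel_left₀ hw',
      abs_norm]

/-- The short-time Fourier transform of a Schwartz function is rapidly decreasing. -/
theorem exists_norm_STFT_le (u : SchwartzMap (EuclideanSpace ℝ (Fin n)) ℂ) {s : ℝ} (hs : 0 ≤ s) :
    ∃ C : ℝ, 0 < C ∧ ∀ z : EuclideanSpace ℝ (Fin n) × EuclideanSpace ℝ (Fin n),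
      ‖STFT n u z.1 z.2‖ ≤ C * phaseWeight z ^ (-s) := by
  obtain ⟨N, hN⟩ := exists_nat_ge s
  set d : ℝ := Module.finrank ℝ (EuclideanSpace ℝ (Fin n)) + 1
  obtain ⟨A, hA, hu⟩ := exists_forall_le_mul_of_forall_exists (fun x => by positivity)
    (fun j => u.exists_norm_iteratedFDeriv_le j (d + s)) N
  obtain ⟨B, hB, hg⟩ := exists_forall_le_mul_of_forall_exists (fun x => by positivity)
    (fun j => exists_norm_iteratedFDeriv_gaussian_le (V := EuclideanSpace ℝ (Fin n)) j s) N
  have hint : Integrable (fun x : EuclideanSpace ℝ (Fin n) => (1 + ‖x‖) ^ (-d)) :=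
    integrable_one_add_norm (lt_add_one _)
  have hI : 0 ≤ ∫ x : EuclideanSpace ℝ (Fin n), (1 + ‖x‖) ^ (-d) :=
    integral_nonneg fun x => by positivity
  have hpi := Real.pi_pos
  refine ⟨2 ^ N * (1 + (4 * Real.pi) ^ N * (N + 1)) *
    (2 ^ N * (A * B) * (1 + ∫ x : EuclideanSpace ℝ (Fin n), (1 + ‖x‖) ^ (-d))), by positivity,
    fun z => ?_⟩
  have hgs : ContDiff ℝ N fun t : EuclideanSpace ℝ (Fin n) =>
      Complex.exp (-((‖t - z.1‖ ^ 2 : ℝ) : ℂ)) :=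
    contDiff_gaussian.comp (contDiff_id.sub contDiff_const)
  have hbound : ∀ j ≤ N, ∀ t, ‖iteratedFDeriv ℝ j
      (fun t => u t * Complex.exp (-((‖t - z.1‖ ^ 2 : ℝ) : ℂ))) t‖ ≤
      (2 ^ N * (A * B) * (1 + ‖z.1‖) ^ (-s)) * (1 + ‖t‖) ^ (-d) := by
    intro j hj t
    have h1 := norm_iteratedFDeriv_mul_le_two_pow (j := j) (z := t)
      (u.smooth j) (hgs.of_le (by exact_mod_cast hj))
      (fun i hi => hu i (hi.trans hj) t) (fun i hi => by
        rw [iteratedFDeriv_comp_sub (f := fun x : EuclideanSpace ℝ (Fin n) =>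
          Complex.exp (-((‖x‖ ^ 2 : ℝ) : ℂ)))]
        exact hg i (hi.trans hj) (t - z.1))
    refine h1.trans ?_
    have hz : 1 + ‖z.1‖ ≤ (1 + ‖t‖) * (1 + ‖t - z.1‖) := by
      have := one_add_norm_add_le t (z.1 - t)
      rwa [add_sub_cancel, norm_sub_rev] at this
    have hz' : (1 + ‖t‖) ^ (-s) * (1 + ‖t - z.1‖) ^ (-s) ≤ (1 + ‖z.1‖) ^ (-s) := by
      rw [← Real.mul_rpow (by positivity) (by positivity)]
      exact Real.rpow_le_rpow_of_nonpos (by positivity) hz (by linarith)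
    have h2 : (2 : ℝ) ^ j ≤ 2 ^ N := pow_le_pow_right₀ (by norm_num) hj
    calc (2 : ℝ) ^ j * (A * (1 + ‖t‖) ^ (-(d + s)) * (B * (1 + ‖t - z.1‖) ^ (-s)))
        ≤ 2 ^ N * (A * (1 + ‖t‖) ^ (-(d + s)) * (B * (1 + ‖t - z.1‖) ^ (-s))) := by gcongr
      _ = 2 ^ N * (A * B) * (((1 + ‖t‖) ^ (-s) * (1 + ‖t - z.1‖) ^ (-s)) * (1 + ‖t‖) ^ (-d)) := by
          rw [neg_add, Real.rpow_add (by positivity)]; ring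
      _ ≤ 2 ^ N * (A * B) * ((1 + ‖z.1‖) ^ (-s) * (1 + ‖t‖) ^ (-d)) := by gcongr
      _ = _ := by ring
  have key := norm_integral_mul_cexp_le_rpow (μ := volume) (innerSL ℝ) (N := N)
    (f := fun t => u t * Complex.exp (-((‖t - z.1‖ ^ 2 : ℝ) : ℂ)))
    ((u.smooth N).mul hgs) hint hbound hN z.2 (exists_norm_eq_abs_inner z.2)
  refine key.trans ?_
  rw [phaseWeight_rpow]
  calc _ ≤ 2 ^ N * (1 + (4 * Real.pi) ^ N * (N + 1)) * (2 ^ N * (A * B) * (1 + ‖z.1‖) ^ (-s) *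
        (1 + ∫ x : EuclideanSpace ℝ (Fin n), (1 + ‖x‖) ^ (-d))) * (1 + ‖z.2‖) ^ (-s) := by
        gcongr; linarith
    _ = _ := by ring

theorem continuous_STFT (u : SchwartzMap (EuclideanSpace ℝ (Fin n)) ℂ) :
    Continuous fun z : EuclideanSpace ℝ (Fin n) × EuclideanSpace ℝ (Fin n) =>
      STFT n u z.1 z.2 := by
  unfold STFT
  refine continuous_of_dominated (bound := fun y => ‖u y‖) (fun z => ?_) (fun z => ?_)
    u.integrable.norm (.of_forall fun y => ?_)
  · have := u.continuous
    exact Continuous.aestronglyMeasurable (by fun_prop)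
  · refine .of_forall fun y => ?_
    rw [norm_mul, norm_mul, Complex.norm_exp, Complex.norm_exp, mul_assoc]
    refine mul_le_of_le_one_right (norm_nonneg _) ?_
    rw [← Real.exp_add]
    refine Real.exp_le_one_iff.2 ?_
    simp only [Complex.neg_re, Complex.ofReal_re, Complex.mul_re, Complex.I_re, Complex.neg_im,
      Complex.I_im, Complex.ofReal_im]
    nlinarith [sq_nonneg ‖y - z.1‖]
  · fun_prop

theorem integrable_STFT (u : SchwartzMap (EuclideanSpace ℝ (Fin n)) ℂ) :
    Integrable fun z : EuclideanSpace ℝ (Fin n) × EuclideanSpace ℝ (Fin n) =>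
      STFT n u z.1 z.2 := by
  obtain ⟨C, -, hb⟩ := exists_norm_STFT_le u
    (s := Module.finrank ℝ (EuclideanSpace ℝ (Fin n)) + 1) (by positivity)
  exact ((integrable_phaseWeight_rpow (lt_add_one _)).const_mul C).mono'
    (continuous_STFT u).aestronglyMeasurable (.of_forall hb)

end ShortTimeFourier

section Reproducing

variable {n : ℕ}

instance isAddHaarMeasure_volume_phaseSpace :
    (volume : Measure (EuclideanSpace ℝ (Fin n) × EuclideanSpace ℝ (Fin n))).IsAddHaarMeasure :=
  inferInstanceAs (Measure.IsAddHaarMeasure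
    ((volume : Measure (EuclideanSpace ℝ (Fin n))).prod volume))

theorem phaseWeight_sub_rpow_le {E : Type*} [NormedAddCommGroup E] {s : ℝ} (hs : 0 ≤ s)
    (z q : E × E) :
    phaseWeight (z - q) ^ (-s) ≤ phaseWeight z ^ (-s) * phaseWeight q ^ s := by
  have h := phaseWeight_rpow_mul_le hs (z - q) q
  rw [sub_add_cancel] at h
  have hq := Real.rpow_pos_of_pos (phaseWeight_pos q) s
  rwa [Real.rpow_neg (phaseWeight_pos q).le, ← div_eq_mul_inv, div_le_iff₀ hq] at h

/-- The pairing `⟨z, ω⟩` on phase space. -/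
def phasePairing (E : Type*) [NormedAddCommGroup E] [InnerProductSpace ℝ E] :
    (E × E) →L[ℝ] (E × E) →L[ℝ] ℝ :=
  (innerSL ℝ).bilinearComp (.fst ℝ E E) (.fst ℝ E E) +
    (innerSL ℝ).bilinearComp (.snd ℝ E E) (.snd ℝ E E)

theorem phasePairing_apply {E : Type*} [NormedAddCommGroup E] [InnerProductSpace ℝ E]
    (z w : E × E) : phasePairing E z w = ⟪z.1, w.1⟫ + ⟪z.2, w.2⟫ := by
  simp [phasePairing]

theorem exists_norm_eq_abs_phasePairing {E : Type*} [NormedAddCommGroup E]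
    [InnerProductSpace ℝ E] (w : E × E) : ∃ v, ‖v‖ ≤ 1 ∧ |phasePairing E v w| = ‖w‖ := by
  rcases le_total ‖w.2‖ ‖w.1‖ with h | h
  · obtain ⟨v, hv, hvw⟩ := exists_norm_eq_abs_inner w.1
    exact ⟨(v, 0), by simpa [Prod.norm_def] using hv, by
      rw [phasePairing_apply, Prod.norm_def, max_eq_left h, ← hvw]; simp⟩
  · obtain ⟨v, hv, hvw⟩ := exists_norm_eq_abs_inner w.2
    exact ⟨(0, v), by simpa [Prod.norm_def] using hv, by
      rw [phasePairing_apply, Prod.norm_def, max_eq_right h, ← hvw]; simp⟩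

/-- The quadratic phase of the reproducing kernel. -/
def kernelPhase {E : Type*} [NormedAddCommGroup E] [InnerProductSpace ℝ E] (z : E × E) : ℂ :=
  Complex.I * (⟪z.1, z.2⟫ : ℝ) - ((‖z.1‖ ^ 2 : ℝ) : ℂ) - ((‖z.2‖ ^ 2 : ℝ) : ℂ)

theorem hasTemperateGrowth_kernelPhase {E : Type*} [NormedAddCommGroup E]
    [InnerProductSpace ℝ E] : (kernelPhase (E := E)).HasTemperateGrowth := by
  have h1 : (fun z : E × E => z.1).HasTemperateGrowth :=
    (ContinuousLinearMap.fst ℝ E E).hasTemperateGrowth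
  have h2 : (fun z : E × E => z.2).HasTemperateGrowth :=
    (ContinuousLinearMap.snd ℝ E E).hasTemperateGrowth
  have h3 : (fun z : E × E => ⟪z.1, z.2⟫).HasTemperateGrowth :=
    (innerSL ℝ).bilinear_hasTemperateGrowth h1 h2
  have h4 : (fun z : E × E => ‖z.1‖ ^ 2).HasTemperateGrowth :=
    (Function.hasTemperateGrowth_norm_sq E).comp h1
  have h5 : (fun z : E × E => ‖z.2‖ ^ 2).HasTemperateGrowth :=
    (Function.hasTemperateGrowth_norm_sq E).comp h2
  unfold kernelPhase
  fun_prop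

theorem kernelPhase_re_le {E : Type*} [NormedAddCommGroup E] [InnerProductSpace ℝ E]
    (z : E × E) : (kernelPhase z).re ≤ -‖z‖ ^ 2 := by
  have h : (kernelPhase z).re = -‖z.1‖ ^ 2 - ‖z.2‖ ^ 2 := by
    simp only [kernelPhase, Complex.sub_re, Complex.mul_re, Complex.I_re, Complex.I_im,
      Complex.ofReal_re, Complex.ofReal_im]
    ring
  rw [h, Prod.norm_def]
  rcases max_choice ‖z.1‖ ‖z.2‖ with h | h <;> rw [h] <;>
    nlinarith [sq_nonneg ‖z.1‖, sq_nonneg ‖z.2‖]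

/-- The integral kernel relating the short-time Fourier transforms of `u` and `a(x,D)u`. -/
def symbolKernel (n : ℕ) (a : (EuclideanSpace ℝ (Fin n) × EuclideanSpace ℝ (Fin n)) → ℂ)
    (q w : EuclideanSpace ℝ (Fin n) × EuclideanSpace ℝ (Fin n)) : ℂ :=
  ∫ z : EuclideanSpace ℝ (Fin n) × EuclideanSpace ℝ (Fin n),
    Complex.exp (Complex.I * (⟪z.1, z.2⟫ : ℝ)) * a z *
      Complex.exp (-((‖z.1 - q.1‖ ^ 2 : ℝ) : ℂ)) * Complex.exp (-Complex.I * (⟪z.1, q.2⟫ : ℝ)) *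
      (Complex.exp (-Complex.I * (⟪w.1, z.2 - w.2⟫ : ℝ)) *
        Complex.exp (-((‖z.2 - w.2‖ ^ 2 : ℝ) : ℂ)))

theorem norm_symbolKernel_eq (a : (EuclideanSpace ℝ (Fin n) × EuclideanSpace ℝ (Fin n)) → ℂ)
    (q w : EuclideanSpace ℝ (Fin n) × EuclideanSpace ℝ (Fin n)) :
    ‖symbolKernel n a q w‖ = ‖∫ z, a ((q.1, w.2) + z) * Complex.exp (kernelPhase z) *
      Complex.exp (-Complex.I *
        (phasePairing (EuclideanSpace ℝ (Fin n)) z (q.2 - w.2, w.1 - q.1) : ℝ))‖ := by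
  have h : symbolKernel n a q w = Complex.exp (Complex.I * (⟪q.1, w.2 - q.2⟫ : ℝ)) *
      ∫ z, a ((q.1, w.2) + z) * Complex.exp (kernelPhase z) *
      Complex.exp (-Complex.I *
        (phasePairing (EuclideanSpace ℝ (Fin n)) z (q.2 - w.2, w.1 - q.1) : ℝ)) := by
    rw [symbolKernel, ← integral_const_mul,
      ← integral_add_left_eq_self _ ((q.1, w.2) :
        EuclideanSpace ℝ (Fin n) × EuclideanSpace ℝ (Fin n))]
    congr 1
    funext z
    rw [mul_comm (Complex.exp _) (a _)]
    simp only [mul_assoc]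
    rw [mul_left_comm (Complex.exp _) (a _)]
    congr 1
    simp only [← Complex.exp_add]
    congr 1
    simp only [phasePairing_apply, kernelPhase, Prod.fst_add, Prod.snd_add, add_sub_cancel_left,
      inner_add_left, inner_add_right, inner_sub_right, real_inner_comm z.2]
    push_cast
    ring
  rw [h, norm_mul, mul_comm Complex.I, Complex.norm_exp_ofReal_mul_I, one_mul]

theorem SigmaClass.exists_norm_iteratedFDeriv_mul_cexp_kernelPhase_le {k l : ℕ} {m : ℝ}
    {a : (EuclideanSpace ℝ (Fin n) × EuclideanSpace ℝ (Fin n)) → ℂ} (ha : SigmaClass n k l m a)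
    {d : ℝ} (hd : 0 ≤ d) :
    ∃ r : ℝ, 0 ≤ r ∧ ∀ N : ℕ, ∃ C : ℝ, 0 < C ∧ ∀ q w, ∀ j ≤ N, ∀ z, ‖iteratedFDeriv ℝ j
      (fun z => a ((q.1, w.2) + z) * Complex.exp (kernelPhase z)) z‖ ≤
      (C * anharmonicWeight k l q ^ m * phaseWeight (q - w) ^ r) * phaseWeight z ^ (-d) := by
  obtain ⟨D, hD, r, hr, hv⟩ :=
    exists_anharmonicWeight_rpow_add_le (E := EuclideanSpace ℝ (Fin n)) k l m
  refine ⟨r, hr, fun N => ?_⟩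
  obtain ⟨A, hA, hab⟩ := exists_forall_le_mul_of_forall_exists
    (fun z => Real.rpow_nonneg (anharmonicWeight_pos k l z).le m)
    ha.exists_norm_iteratedFDeriv_le N
  obtain ⟨B, hB, hg⟩ := exists_forall_le_mul_of_forall_exists (fun x => by positivity)
    (fun j => exists_norm_iteratedFDeriv_cexp_comp_le
      (hasTemperateGrowth_kernelPhase (E := EuclideanSpace ℝ (Fin n))) kernelPhase_re_le j
      (2 * (r + d))) N
  refine ⟨2 ^ N * (A * D * B), by positivity, fun q w j hj z => ?_⟩
  have hq := Real.rpow_pos_of_pos (anharmonicWeight_pos k l q) m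
  have hqw := phaseWeight_pos (q - w)
  have hqwr := Real.rpow_pos_of_pos hqw r
  have has : ContDiff ℝ N fun z => a ((q.1, w.2) + z) :=
    (ha.1.of_le (by exact_mod_cast le_top)).comp (contDiff_const.add contDiff_id)
  have hes : ContDiff ℝ N fun z : EuclideanSpace ℝ (Fin n) × EuclideanSpace ℝ (Fin n) =>
      Complex.exp (kernelPhase z) :=
    Complex.contDiff_exp.comp (hasTemperateGrowth_kernelPhase.1.of_le (by exact_mod_cast le_top))
  have h1 := norm_iteratedFDeriv_mul_le_two_pow (j := j) (z := z)
    (has.of_le (by exact_mod_cast hj)) (hes.of_le (by exact_mod_cast hj))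
    (fun i hi => by
      rw [iteratedFDeriv_comp_add_left]
      exact hab i (hi.trans hj) _) (fun i hi => hg i (hi.trans hj) z)
  refine h1.trans ?_
  have h2 : (2 : ℝ) ^ j ≤ 2 ^ N := pow_le_pow_right₀ (by norm_num) hj
  have hz := phaseWeight_pos z
  have hw2 : phaseWeight ((0, w.2 - q.2) : EuclideanSpace ℝ (Fin n) × EuclideanSpace ℝ (Fin n))
      ≤ phaseWeight (q - w) := by
    simp only [phaseWeight, norm_zero, add_zero, one_mul, Prod.fst_sub, Prod.snd_sub]
    rw [norm_sub_rev w.2]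
    exact le_mul_of_one_le_left (by positivity) (by linarith [norm_nonneg (q.1 - w.1)])
  have h3 : anharmonicWeight k l ((q.1, w.2) + z) ^ m ≤
      D * anharmonicWeight k l q ^ m * (phaseWeight z ^ r * phaseWeight (q - w) ^ r) := by
    have e : (q.1, w.2) + z = q + (z + (0, w.2 - q.2)) :=
      Prod.ext (by simp) (by simp only [Prod.snd_add]; abel)
    rw [e]
    refine (hv _ _).trans ?_
    gcongr
    rw [← Real.mul_rpow hz.le hqw.le]
    refine Real.rpow_le_rpow (phaseWeight_pos _).le ((phaseWeight_add_le _ _).trans ?_) hr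
    gcongr
  have h4 := one_add_norm_rpow_le_phaseWeight (s := r + d) (by positivity) z
  have hzr := Real.rpow_pos_of_pos hz r
  have hva := Real.rpow_pos_of_pos (anharmonicWeight_pos k l ((q.1, w.2) + z)) m
  calc (2 : ℝ) ^ j * (A * anharmonicWeight k l ((q.1, w.2) + z) ^ m *
        (B * (1 + ‖z‖) ^ (-(2 * (r + d)))))
      ≤ 2 ^ N * (A * (D * anharmonicWeight k l q ^ m *
        (phaseWeight z ^ r * phaseWeight (q - w) ^ r)) * (B * phaseWeight z ^ (-(r + d)))) := by
        gcongr
    _ = 2 ^ N * (A * D * B) * anharmonicWeight k l q ^ m * phaseWeight (q - w) ^ r *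
        (phaseWeight z ^ r * phaseWeight z ^ (-(r + d))) := by ring
    _ = _ := by rw [← Real.rpow_add hz]; ring_nf

/-- Off-diagonal decay of the kernel. -/
theorem SigmaClass.exists_norm_symbolKernel_le {k l : ℕ} {m : ℝ}
    {a : (EuclideanSpace ℝ (Fin n) × EuclideanSpace ℝ (Fin n)) → ℂ} (ha : SigmaClass n k l m a)
    {s : ℝ} (hs : 0 ≤ s) :
    ∃ C : ℝ, 0 < C ∧ ∀ q w, ‖symbolKernel n a q w‖ ≤
      C * anharmonicWeight k l q ^ m * phaseWeight (q - w) ^ (-s) := by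
  obtain ⟨r, hr, hbound⟩ := ha.exists_norm_iteratedFDeriv_mul_cexp_kernelPhase_le
    (d := Module.finrank ℝ (EuclideanSpace ℝ (Fin n)) + 1) (by positivity)
  obtain ⟨N, hN⟩ := exists_nat_ge (2 * (s + r))
  obtain ⟨C, hC, hbound⟩ := hbound N
  have hint : Integrable fun z : EuclideanSpace ℝ (Fin n) × EuclideanSpace ℝ (Fin n) =>
      phaseWeight z ^ (-((Module.finrank ℝ (EuclideanSpace ℝ (Fin n)) : ℝ) + 1)) :=
    integrable_phaseWeight_rpow (lt_add_one _)
  have hes : ContDiff ℝ N fun z : EuclideanSpace ℝ (Fin n) × EuclideanSpace ℝ (Fin n) =>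
      Complex.exp (kernelPhase z) :=
    Complex.contDiff_exp.comp (hasTemperateGrowth_kernelPhase.1.of_le (by exact_mod_cast le_top))
  have key := fun q w : EuclideanSpace ℝ (Fin n) × EuclideanSpace ℝ (Fin n) =>
    norm_integral_mul_cexp_le_rpow (μ := volume) (phasePairing _)
      (((ha.1.of_le (by exact_mod_cast le_top)).comp
        (contDiff_const (c := (q.1, w.2)) |>.add contDiff_id)).mul hes) hint
      (hbound q w) hN (q.2 - w.2, w.1 - q.1) (exists_norm_eq_abs_phasePairing _)
  set I := ∫ z : EuclideanSpace ℝ (Fin n) × EuclideanSpace ℝ (Fin n),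
    phaseWeight z ^ (-((Module.finrank ℝ (EuclideanSpace ℝ (Fin n)) : ℝ) + 1)) with hI
  have hI0 : 0 ≤ I := integral_nonneg fun z => Real.rpow_nonneg (phaseWeight_pos z).le _
  have hK : (0 : ℝ) < 2 ^ N * (1 + (4 * Real.pi) ^ N * (N + 1)) := by
    have := Real.pi_pos
    positivity
  generalize (2 : ℝ) ^ N * (1 + (4 * Real.pi) ^ N * (N + 1)) = K at key hK
  clear_value I
  refine ⟨K * (C * (I + 1)), by positivity, fun q w => ?_⟩
  have hq := Real.rpow_pos_of_pos (anharmonicWeight_pos k l q) m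
  have hqw := phaseWeight_pos (q - w)
  have hqwr := Real.rpow_pos_of_pos hqw r
  have hω : (1 + ‖((q.2 - w.2, w.1 - q.1) : EuclideanSpace ℝ (Fin n) × EuclideanSpace ℝ (Fin n))‖)
      ^ (-(2 * (s + r))) ≤ phaseWeight (q - w) ^ (-(s + r)) := by
    refine (one_add_norm_rpow_le_phaseWeight (by positivity) _).trans_eq ?_
    congr 1
    simp only [phaseWeight, Prod.fst_sub, Prod.snd_sub]
    rw [norm_sub_rev w.1, mul_comm]
  rw [norm_symbolKernel_eq]
  refine (key q w).trans ((mul_le_mul_of_nonneg_left hω (by positivity)).trans ?_)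
  calc _ ≤ K * (C * anharmonicWeight k l q ^ m * phaseWeight (q - w) ^ r * (I + 1)) *
        phaseWeight (q - w) ^ (-(s + r)) := by
        have := Real.rpow_nonneg hqw.le (-(s + r))
        refine mul_le_mul_of_nonneg_right ?_ this
        refine mul_le_mul_of_nonneg_left ?_ hK.le
        refine mul_le_mul_of_nonneg_left ?_ (by positivity)
        linarith
    _ = K * (C * (I + 1)) * anharmonicWeight k l q ^ m *
        (phaseWeight (q - w) ^ r * phaseWeight (q - w) ^ (-(s + r))) := by ring
    _ = _ := by rw [← Real.rpow_add hqw]; ring_nf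

end Reproducing

section Inversion

variable {n : ℕ}

theorem norm_cexp_neg_I_mul (t : ℝ) : ‖Complex.exp (-Complex.I * t)‖ = 1 := by
  rw [neg_mul, mul_comm, ← neg_mul, ← Complex.ofReal_neg, Complex.norm_exp_ofReal_mul_I]

theorem norm_cexp_neg_norm_sq_le {V : Type*} [NormedAddCommGroup V] (x : V) :
    ‖Complex.exp (-((‖x‖ ^ 2 : ℝ) : ℂ))‖ ≤ 1 := by
  rw [← Complex.ofReal_neg, Complex.norm_exp_ofReal]
  exact Real.exp_le_one_iff.2 (by nlinarith [sq_nonneg ‖x‖])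

theorem integrable_gaussian : Integrable fun x : EuclideanSpace ℝ (Fin n) =>
    Complex.exp (-((‖x‖ ^ 2 : ℝ) : ℂ)) := by
  have := GaussianFourier.integrable_cexp_neg_mul_sq_norm_add (V := EuclideanSpace ℝ (Fin n))
    (b := 1) (by simp) 0 0
  simpa using this

theorem integral_gaussian_mul_cexp (ω : EuclideanSpace ℝ (Fin n)) :
    ∫ r : EuclideanSpace ℝ (Fin n), Complex.exp (-((‖r‖ ^ 2 : ℝ) : ℂ)) *
      Complex.exp (Complex.I * (⟪r, ω⟫ : ℝ)) =
      (Real.pi : ℂ) ^ (n / 2 : ℂ) * Complex.exp (-(‖ω‖ ^ 2 / 4 : ℝ)) := by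
  have := GaussianFourier.integral_cexp_neg_mul_sq_norm_add (V := EuclideanSpace ℝ (Fin n))
    (b := 1) (by simp) Complex.I ω
  simp only [← Complex.exp_add]
  convert this using 1
  · congr 1
    funext r
    rw [real_inner_comm]
    push_cast
    ring_nf
  · simp only [finrank_euclideanSpace, Fintype.card_fin, div_one, Complex.I_sq]
    push_cast
    ring_nf

theorem integral_STFT_mul_cexp (u : SchwartzMap (EuclideanSpace ℝ (Fin n)) ℂ)
    (η ω : EuclideanSpace ℝ (Fin n)) :
    ∫ y, STFT n u y η * Complex.exp (-Complex.I * (⟪y, ω⟫ : ℝ)) =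
      FT n u (η + ω) * ((Real.pi : ℂ) ^ (n / 2 : ℂ) * Complex.exp (-(‖ω‖ ^ 2 / 4 : ℝ))) := by
  have hint : Integrable (fun z : EuclideanSpace ℝ (Fin n) × EuclideanSpace ℝ (Fin n) =>
      (u z.2 * Complex.exp (-((‖z.2 - z.1‖ ^ 2 : ℝ) : ℂ))) *
        (Complex.exp (-Complex.I * (⟪z.2, η⟫ : ℝ)) * Complex.exp (-Complex.I * (⟪z.1, ω⟫ : ℝ)))) := by
    refine Integrable.mul_bdd (c := 1) ?_ ?_ ?_
    · have := u.integrable.convolution_integrand (μ := volume) (ν := volume)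
        (ContinuousLinearMap.mul ℝ ℂ) integrable_gaussian
      simp_rw [norm_sub_rev _ (Prod.fst _)]
      exact this
    · exact Continuous.aestronglyMeasurable (by fun_prop)
    · refine .of_forall fun z => ?_
      rw [norm_mul, norm_cexp_neg_I_mul, norm_cexp_neg_I_mul, one_mul]
  simp only [STFT, ← integral_mul_const]
  simp only [mul_assoc] at hint ⊢
  rw [integral_integral_swap hint, FT, ← integral_mul_const]
  congr 1
  funext t
  rw [← integral_sub_left_eq_self _ volume t, ← integral_gaussian_mul_cexp, ← integral_const_mul]
  congr 1
  funext r
  rw [sub_sub_cancel]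
  simp only [mul_assoc]
  congr 1
  simp only [← Complex.exp_add, inner_sub_left, inner_add_right]
  push_cast
  ring_nf

/-- The normalising constant of the inversion formula `FT_mul_inversionConst`. -/
def inversionConst (n : ℕ) : ℂ :=
  ∫ ω : EuclideanSpace ℝ (Fin n), ((Real.pi : ℂ) ^ (n / 2 : ℂ) *
    Complex.exp (-(‖ω‖ ^ 2 / 4 : ℝ))) * Complex.exp (-((‖ω‖ ^ 2 : ℝ) : ℂ))

theorem inversionConst_ne_zero (n : ℕ) : inversionConst n ≠ 0 := by
  have := GaussianFourier.integral_cexp_neg_mul_sq_norm (V := EuclideanSpace ℝ (Fin n))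
    (b := 5 / 4) (by norm_num)
  have h : inversionConst n = (Real.pi : ℂ) ^ (n / 2 : ℂ) *
      ∫ ω : EuclideanSpace ℝ (Fin n), Complex.exp (-(5 / 4) * ‖ω‖ ^ 2) := by
    rw [inversionConst, ← integral_const_mul]
    congr 1
    funext ω
    rw [mul_assoc, ← Complex.exp_add]
    push_cast
    ring_nf
  have hpi : (Real.pi : ℂ) ≠ 0 := by exact_mod_cast Real.pi_ne_zero
  rw [h, this]
  refine mul_ne_zero ?_ ?_ <;> rw [Complex.cpow_def_of_ne_zero (by simp [hpi])] <;>
    exact Complex.exp_ne_zero _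

/-- The Fourier transform is recovered from the short-time Fourier transform. -/
theorem FT_mul_inversionConst (u : SchwartzMap (EuclideanSpace ℝ (Fin n)) ℂ)
    (ζ : EuclideanSpace ℝ (Fin n)) :
    FT n u ζ * inversionConst n =
      ∫ w : EuclideanSpace ℝ (Fin n) × EuclideanSpace ℝ (Fin n), STFT n u w.1 w.2 *
        (Complex.exp (-Complex.I * (⟪w.1, ζ - w.2⟫ : ℝ)) *
          Complex.exp (-((‖ζ - w.2‖ ^ 2 : ℝ) : ℂ))) := by
  have hint : Integrable fun w : EuclideanSpace ℝ (Fin n) × EuclideanSpace ℝ (Fin n) =>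
      STFT n u w.1 w.2 * (Complex.exp (-Complex.I * (⟪w.1, ζ - w.2⟫ : ℝ)) *
          Complex.exp (-((‖ζ - w.2‖ ^ 2 : ℝ) : ℂ))) := by
    refine (integrable_STFT u).mul_bdd (c := 1) ?_ (.of_forall fun w => ?_)
    · exact Continuous.aestronglyMeasurable (by fun_prop)
    · rw [norm_mul, norm_cexp_neg_I_mul, one_mul]
      exact norm_cexp_neg_norm_sq_le _
  rw [Measure.volume_eq_prod] at hint ⊢
  rw [integral_prod_symm _ hint]
  simp only [← mul_assoc, integral_mul_const, integral_STFT_mul_cexp, add_sub_cancel]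
  rw [inversionConst, ← integral_const_mul, ← integral_sub_left_eq_self _ volume ζ]
  simp only [mul_assoc]

end Inversion

section KernelRepresentation

variable {n : ℕ}

theorem SigmaClass.exists_norm_le_phaseWeight {k l : ℕ} {m : ℝ}
    {a : (EuclideanSpace ℝ (Fin n) × EuclideanSpace ℝ (Fin n)) → ℂ} (ha : SigmaClass n k l m a) :
    ∃ C : ℝ, 0 < C ∧ ∃ s : ℝ, 0 ≤ s ∧ ∀ z, ‖a z‖ ≤ C * phaseWeight z ^ s := by
  obtain ⟨D, hD, r, hr, hv⟩ :=
    exists_anharmonicWeight_rpow_add_le (E := EuclideanSpace ℝ (Fin n)) k l m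
  obtain ⟨A, hA, hab⟩ := ha.exists_norm_iteratedFDeriv_le 0
  have h0 := Real.rpow_pos_of_pos (anharmonicWeight_pos (E := EuclideanSpace ℝ (Fin n)) k l 0) m
  refine ⟨A * (D * anharmonicWeight k l (0 : EuclideanSpace ℝ (Fin n) × _) ^ m), by positivity,
    r, hr, fun z => ?_⟩
  have h1 := hab z
  have h2 := hv 0 z
  rw [norm_iteratedFDeriv_zero] at h1
  rw [zero_add] at h2
  rw [mul_assoc]
  exact h1.trans (mul_le_mul_of_nonneg_left h2 hA.le)

theorem exists_norm_gaussian_mul_gaussian_le {s : ℝ} (hs : 0 ≤ s) :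
    ∃ C : ℝ, 0 < C ∧ ∀ q z w : EuclideanSpace ℝ (Fin n) × EuclideanSpace ℝ (Fin n),
      ‖Complex.exp (-((‖z.1 - q.1‖ ^ 2 : ℝ) : ℂ)) * Complex.exp (-((‖z.2 - w.2‖ ^ 2 : ℝ) : ℂ))‖ ≤
        C * (1 + ‖q.1‖) ^ s * phaseWeight z ^ (-s) * phaseWeight w ^ s := by
  obtain ⟨C, hC, h⟩ := exists_pow_mul_exp_neg_sq_le s
  refine ⟨C * C, by positivity, fun q z w => ?_⟩
  have hz := phaseWeight_pos z
  have hw := phaseWeight_pos w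
  have h1 : phaseWeight (z - (q.1, w.2)) ^ (-s) ≤
      phaseWeight z ^ (-s) * ((1 + ‖q.1‖) ^ s * phaseWeight w ^ s) := by
    refine (phaseWeight_sub_rpow_le hs z (q.1, w.2)).trans ?_
    have : phaseWeight ((q.1, w.2) : EuclideanSpace ℝ (Fin n) × EuclideanSpace ℝ (Fin n)) ^ s ≤
        (1 + ‖q.1‖) ^ s * phaseWeight w ^ s := by
      rw [← Real.mul_rpow (by positivity) hw.le]
      refine Real.rpow_le_rpow (phaseWeight_pos _).le ?_ hs
      simp only [phaseWeight]
      gcongr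
      exact le_mul_of_one_le_left (by positivity) (by linarith [norm_nonneg w.1])
    have hz' := Real.rpow_pos_of_pos hz (-s)
    gcongr
  rw [norm_mul, ← Complex.ofReal_neg, ← Complex.ofReal_neg, Complex.norm_exp_ofReal,
    Complex.norm_exp_ofReal]
  calc _ ≤ (C * (1 + ‖z.1 - q.1‖) ^ (-s)) * (C * (1 + ‖z.2 - w.2‖) ^ (-s)) := by
        gcongr
        · exact h _ (norm_nonneg _)
        · exact h _ (norm_nonneg _)
    _ = C * C * phaseWeight (z - (q.1, w.2)) ^ (-s) := by
        rw [phaseWeight_rpow]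
        simp only [Prod.fst_sub, Prod.snd_sub]
        ring
    _ ≤ C * C * (phaseWeight z ^ (-s) * ((1 + ‖q.1‖) ^ s * phaseWeight w ^ s)) := by gcongr
    _ = _ := by ring

theorem integrable_STFT_mul_symbolKernel_integrand
    {a : (EuclideanSpace ℝ (Fin n) × EuclideanSpace ℝ (Fin n)) → ℂ} (hac : Continuous a)
    {A s : ℝ} (hA : 0 < A) (hs : 0 ≤ s) (ha : ∀ z, ‖a z‖ ≤ A * phaseWeight z ^ s)
    (u : SchwartzMap (EuclideanSpace ℝ (Fin n)) ℂ)
    (q : EuclideanSpace ℝ (Fin n) × EuclideanSpace ℝ (Fin n)) :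
    Integrable (fun p : (EuclideanSpace ℝ (Fin n) × EuclideanSpace ℝ (Fin n)) ×
        (EuclideanSpace ℝ (Fin n) × EuclideanSpace ℝ (Fin n)) => STFT n u p.2.1 p.2.2 *
      (Complex.exp (Complex.I * (⟪p.1.1, p.1.2⟫ : ℝ)) * a p.1 *
        Complex.exp (-((‖p.1.1 - q.1‖ ^ 2 : ℝ) : ℂ)) *
        Complex.exp (-Complex.I * (⟪p.1.1, q.2⟫ : ℝ)) *
        (Complex.exp (-Complex.I * (⟪p.2.1, p.1.2 - p.2.2⟫ : ℝ)) *
        Complex.exp (-((‖p.1.2 - p.2.2‖ ^ 2 : ℝ) : ℂ))))) := by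
  set σ : ℝ := Module.finrank ℝ (EuclideanSpace ℝ (Fin n)) + 1
  have hσ : 0 ≤ σ := by positivity
  obtain ⟨B, hB, hu⟩ := exists_norm_STFT_le u (s := s + σ + σ) (by positivity)
  obtain ⟨C, hC, hg⟩ := exists_norm_gaussian_mul_gaussian_le (n := n) (s := s + σ) (by positivity)
  have hint : Integrable fun z : EuclideanSpace ℝ (Fin n) × EuclideanSpace ℝ (Fin n) =>
      phaseWeight z ^ (-σ) := integrable_phaseWeight_rpow (lt_add_one _)
  have hST := continuous_STFT u
  refine ((hint.mul_prod hint).const_mul (B * A * C * (1 + ‖q.1‖) ^ (s + σ))).mono' ?_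
    (.of_forall fun p => ?_)
  · have h1 : Continuous fun p : (EuclideanSpace ℝ (Fin n) × EuclideanSpace ℝ (Fin n)) ×
        (EuclideanSpace ℝ (Fin n) × EuclideanSpace ℝ (Fin n)) => STFT n u p.2.1 p.2.2 :=
      hST.comp continuous_snd
    exact (h1.mul (by fun_prop)).aestronglyMeasurable
  · have hz := phaseWeight_pos p.1
    have hw := phaseWeight_pos p.2
    have hzs := Real.rpow_pos_of_pos hz s
    have hws := Real.rpow_pos_of_pos hw (-(s + σ + σ))
    have hg := hg q p.1 p.2
    rw [norm_mul] at hg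
    simp only [norm_mul, norm_cexp_neg_I_mul, mul_comm Complex.I, Complex.norm_exp_ofReal_mul_I,
      one_mul, mul_one]
    calc ‖STFT n u p.2.1 p.2.2‖ * (‖a p.1‖ * ‖Complex.exp (-((‖p.1.1 - q.1‖ ^ 2 : ℝ) : ℂ))‖ *
          ‖Complex.exp (-((‖p.1.2 - p.2.2‖ ^ 2 : ℝ) : ℂ))‖)
        ≤ (B * phaseWeight p.2 ^ (-(s + σ + σ))) * ((A * phaseWeight p.1 ^ s) *
          (C * (1 + ‖q.1‖) ^ (s + σ) * phaseWeight p.1 ^ (-(s + σ)) *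
            phaseWeight p.2 ^ (s + σ))) := by
          rw [mul_assoc ‖a p.1‖]
          gcongr
          · exact hu p.2
          · exact ha p.1
      _ = B * A * C * (1 + ‖q.1‖) ^ (s + σ) *
          ((phaseWeight p.1 ^ s * phaseWeight p.1 ^ (-(s + σ))) *
            (phaseWeight p.2 ^ (-(s + σ + σ)) * phaseWeight p.2 ^ (s + σ))) := by ring
      _ = _ := by
          rw [← Real.rpow_add hz, ← Real.rpow_add hw]
          ring_nf

/-- The short-time Fourier transform of `a(x,D)u` in terms of that of `u`. -/
theorem STFT_KNQuant_eq {a : (EuclideanSpace ℝ (Fin n) × EuclideanSpace ℝ (Fin n)) → ℂ}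
    (hac : Continuous a) {A s : ℝ} (hA : 0 < A) (hs : 0 ≤ s)
    (ha : ∀ z, ‖a z‖ ≤ A * phaseWeight z ^ s)
    (u : SchwartzMap (EuclideanSpace ℝ (Fin n)) ℂ)
    (q : EuclideanSpace ℝ (Fin n) × EuclideanSpace ℝ (Fin n)) :
    (((2 * Real.pi) ^ n : ℝ) : ℂ) * inversionConst n * STFT n (KNQuant n a u) q.1 q.2 =
      ∫ w : EuclideanSpace ℝ (Fin n) × EuclideanSpace ℝ (Fin n),
        STFT n u w.1 w.2 * symbolKernel n a q w := by
  have hint := integrable_STFT_mul_symbolKernel_integrand hac hA hs ha u q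
  have hpi : (((2 * Real.pi) ^ n : ℝ) : ℂ) ≠ 0 := by
    have := Real.pi_pos
    exact_mod_cast (by positivity : (2 * Real.pi) ^ n ≠ 0)
  simp only [symbolKernel, ← integral_const_mul]
  rw [← integral_integral_swap hint]
  have h2 : ∀ z : EuclideanSpace ℝ (Fin n) × EuclideanSpace ℝ (Fin n),
      ∫ w : EuclideanSpace ℝ (Fin n) × EuclideanSpace ℝ (Fin n), STFT n u w.1 w.2 *
      (Complex.exp (Complex.I * (⟪z.1, z.2⟫ : ℝ)) * a z *
        Complex.exp (-((‖z.1 - q.1‖ ^ 2 : ℝ) : ℂ)) *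
        Complex.exp (-Complex.I * (⟪z.1, q.2⟫ : ℝ)) *
        (Complex.exp (-Complex.I * (⟪w.1, z.2 - w.2⟫ : ℝ)) *
        Complex.exp (-((‖z.2 - w.2‖ ^ 2 : ℝ) : ℂ)))) =
      (Complex.exp (Complex.I * (⟪z.1, z.2⟫ : ℝ)) * a z * FT n u z.2) *
        (inversionConst n * Complex.exp (-((‖z.1 - q.1‖ ^ 2 : ℝ) : ℂ)) *
        Complex.exp (-Complex.I * (⟪z.1, q.2⟫ : ℝ))) := by
    intro z
    trans (Complex.exp (Complex.I * (⟪z.1, z.2⟫ : ℝ)) * a z *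
        Complex.exp (-((‖z.1 - q.1‖ ^ 2 : ℝ) : ℂ)) *
        Complex.exp (-Complex.I * (⟪z.1, q.2⟫ : ℝ))) * (FT n u z.2 * inversionConst n)
    · rw [FT_mul_inversionConst, ← integral_const_mul]
      exact integral_congr_ae (.of_forall fun w => mul_left_comm _ _ _)
    · ring
  have h3 := hint.integral_prod_left
  simp only [h2] at h3 ⊢
  rw [Measure.volume_eq_prod] at h3 ⊢
  rw [integral_prod _ h3]
  simp only [integral_mul_const]
  rw [STFT, ← integral_const_mul]
  congr 1
  funext y
  rw [KNQuant, Complex.real_smul, Complex.ofReal_inv]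
  field_simp

end KernelRepresentation

section PointwiseEstimate

variable {n : ℕ}

open scoped FourierTransform

theorem FT_eq_fourier (u : EuclideanSpace ℝ (Fin n) → ℂ) (w : EuclideanSpace ℝ (Fin n)) :
    FT n u ((2 * Real.pi) • w) = 𝓕 u w := by
  rw [Real.fourier_eq', FT]
  congr 1
  funext y
  rw [real_inner_smul_right, smul_eq_mul, mul_comm]
  congr 2
  push_cast
  ring

theorem KNQuant_one (u : SchwartzMap (EuclideanSpace ℝ (Fin n)) ℂ) :
    KNQuant n (fun _ => 1) u = u := by
  funext x
  have hinv := congrFun (u.continuous.fourierInv_fourier_eq u.integrable (𝓕 u).integrable) x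
  have hpi := Real.pi_pos
  have h := Measure.integral_comp_smul (volume : Measure (EuclideanSpace ℝ (Fin n)))
    (fun ξ => Complex.exp (Complex.I * (⟪x, ξ⟫ : ℝ)) * 1 * FT n u ξ) (2 * Real.pi)
  rw [finrank_euclideanSpace_fin, abs_of_pos (by positivity)] at h
  rw [KNQuant, ← h, ← hinv, Real.fourierInv_eq']
  congr 1
  funext w
  rw [FT_eq_fourier, smul_eq_mul, mul_one, real_inner_smul_right, real_inner_comm]
  congr 2
  push_cast
  ring

theorem pderivSeq_const (c : ℂ) {L : List (Fin n ⊕ Fin n)} (hL : L ≠ []) :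
    pderivSeq n L (fun _ => c) = 0 := by
  induction L with
  | nil => exact absurd rfl hL
  | cons i L ih =>
    funext p
    rcases eq_or_ne L [] with rfl | h
    · simp [pderivSeq]
    · simp [pderivSeq, ih h]

theorem sigmaClass_one : SigmaClass n 1 1 0 (fun _ => 1) := by
  refine ⟨contDiff_const, fun β α => ⟨1, one_pos, fun x ξ => ?_⟩⟩
  by_cases h : β.map Sum.inl ++ α.map Sum.inr = ([] : List (Fin n ⊕ Fin n))
  · obtain ⟨h1, h2⟩ := List.append_eq_nil_iff.1 h
    rw [List.map_eq_nil_iff] at h1 h2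
    subst h1 h2
    simp [pderivSeq]
  · rw [pderivSeq_const _ h]
    simp only [Pi.zero_apply, norm_zero]
    positivity

/-- Pointwise control of the short-time Fourier transform of `a(x,D)u`. -/
theorem SigmaClass.exists_STFT_KNQuant_le {k l : ℕ} {m : ℝ}
    {a : (EuclideanSpace ℝ (Fin n) × EuclideanSpace ℝ (Fin n)) → ℂ}
    (ha : SigmaClass n k l (-m) a) {s : ℝ} (hs : 0 ≤ s) :
    ∃ C : ℝ, 0 < C ∧ ∀ (u : SchwartzMap (EuclideanSpace ℝ (Fin n)) ℂ) q,
      ENNReal.ofReal (‖STFT n (KNQuant n a u) q.1 q.2‖ * anharmonicWeight k l q ^ m) ≤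
        ENNReal.ofReal C * ∫⁻ w : EuclideanSpace ℝ (Fin n) × EuclideanSpace ℝ (Fin n),
          ENNReal.ofReal (phaseWeight (q - w) ^ (-s)) * ‖STFT n u w.1 w.2‖ₑ := by
  obtain ⟨A, hA, r, hr, hab⟩ := ha.exists_norm_le_phaseWeight
  obtain ⟨C, hC, hK⟩ := ha.exists_norm_symbolKernel_le hs
  set c := (((2 * Real.pi) ^ n : ℝ) : ℂ) * inversionConst n with hc
  have hc0 : 0 < ‖c‖ := by
    have := Real.pi_pos
    rw [norm_pos_iff]
    exact mul_ne_zero (by exact_mod_cast (by positivity : (2 * Real.pi) ^ n ≠ 0))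
      (inversionConst_ne_zero n)
  refine ⟨‖c‖⁻¹ * C, by positivity, fun u q => ?_⟩
  have hv := anharmonicWeight_pos k l q
  have hvm := Real.rpow_pos_of_pos hv m
  have hrep := STFT_KNQuant_eq ha.1.continuous hA hr hab u q
  have h1 : ‖STFT n (KNQuant n a u) q.1 q.2‖ = ‖c‖⁻¹ *
      ‖∫ w : EuclideanSpace ℝ (Fin n) × EuclideanSpace ℝ (Fin n),
        STFT n u w.1 w.2 * symbolKernel n a q w‖ := by
    rw [← hrep, ← hc, norm_mul c, inv_mul_cancel_left₀ hc0.ne']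
  have h2 : ENNReal.ofReal ‖∫ w : EuclideanSpace ℝ (Fin n) × EuclideanSpace ℝ (Fin n),
        STFT n u w.1 w.2 * symbolKernel n a q w‖ ≤
      ENNReal.ofReal (C * anharmonicWeight k l q ^ (-m)) *
        ∫⁻ w : EuclideanSpace ℝ (Fin n) × EuclideanSpace ℝ (Fin n),
          ENNReal.ofReal (phaseWeight (q - w) ^ (-s)) * ‖STFT n u w.1 w.2‖ₑ := by
    rw [ofReal_norm, ← lintegral_const_mul' _ _ ENNReal.ofReal_ne_top]
    refine (enorm_integral_le_lintegral_enorm _).trans (lintegral_mono fun w => ?_)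
    have hvm' := Real.rpow_nonneg hv.le (-m)
    rw [enorm_mul, mul_comm, ← mul_assoc, ← ENNReal.ofReal_mul (by positivity),
      ← ofReal_norm (symbolKernel n a q w)]
    gcongr
    exact hK q w
  rw [h1, ENNReal.ofReal_mul (by positivity), ENNReal.ofReal_mul (by positivity)]
  calc _ ≤ ENNReal.ofReal ‖c‖⁻¹ * (ENNReal.ofReal (C * anharmonicWeight k l q ^ (-m)) *
        ∫⁻ w : EuclideanSpace ℝ (Fin n) × EuclideanSpace ℝ (Fin n),
          ENNReal.ofReal (phaseWeight (q - w) ^ (-s)) * ‖STFT n u w.1 w.2‖ₑ) *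
        ENNReal.ofReal (anharmonicWeight k l q ^ m) := by gcongr
    _ = (ENNReal.ofReal ‖c‖⁻¹ * ENNReal.ofReal (C * anharmonicWeight k l q ^ (-m)) *
        ENNReal.ofReal (anharmonicWeight k l q ^ m)) *
        ∫⁻ w : EuclideanSpace ℝ (Fin n) × EuclideanSpace ℝ (Fin n),
          ENNReal.ofReal (phaseWeight (q - w) ^ (-s)) * ‖STFT n u w.1 w.2‖ₑ := by ring
    _ = _ := by
      rw [← ENNReal.ofReal_mul (by positivity), ← ENNReal.ofReal_mul (by positivity)]
      congr 2
      rw [mul_assoc, mul_assoc C, ← Real.rpow_add hv, neg_add_cancel, Real.rpow_zero, mul_one]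

/-- Self-improvement of the short-time Fourier transform. -/
theorem exists_enorm_STFT_le {s : ℝ} (hs : 0 ≤ s) :
    ∃ C : ℝ, 0 < C ∧ ∀ (u : SchwartzMap (EuclideanSpace ℝ (Fin n)) ℂ)
      (q : EuclideanSpace ℝ (Fin n) × EuclideanSpace ℝ (Fin n)),
      ‖STFT n u q.1 q.2‖ₑ ≤
        ENNReal.ofReal C * ∫⁻ w : EuclideanSpace ℝ (Fin n) × EuclideanSpace ℝ (Fin n),
          ENNReal.ofReal (phaseWeight (q - w) ^ (-s)) * ‖STFT n u w.1 w.2‖ₑ := by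
  have h1 : SigmaClass n 1 1 (-0) (fun _ => 1) := by
    rw [neg_zero]
    exact sigmaClass_one
  obtain ⟨C, hC, h⟩ := h1.exists_STFT_KNQuant_le hs
  refine ⟨C, hC, fun u q => ?_⟩
  have := h u q
  rwa [KNQuant_one, Real.rpow_zero, mul_one, ofReal_norm] at this

end PointwiseEstimate

section ReverseHolder

variable {α : Type*} [AddCommGroup α] [MeasurableSpace α] {μ : Measure α}

/-- A function dominated by its own convolution with a supermultiplicative kernel satisfies a
reverse Hölder type inequality below exponent one. -/
theorem lintegral_mul_rpow_le_of_le_lintegral {k F : α → ℝ≥0∞} (hk1 : ∀ z, k z ≤ 1)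
    (hk : ∀ z w, k z * k w ≤ k (z + w)) {B C : ℝ≥0∞} (hB : B ≠ ∞)
    (hFB : ∀ z, F z ≤ B) (hF : ∀ z, F z ≤ C * ∫⁻ w, k (z - w) * F w ∂μ)
    {r : ℝ} (hr : 0 < r) (hr1 : r ≤ 1) (z : α) :
    (∫⁻ w, k (z - w) * F w ∂μ) ^ r ≤ C ^ (1 - r) * ∫⁻ w, (k (z - w) * F w) ^ r ∂μ := by
  have hr1' : 0 ≤ 1 - r := sub_nonneg.2 hr1
  set G := ⨆ w, k (z - w) * F w with hG
  have hGle : ∀ w, k (z - w) * F w ≤ G := fun w => le_iSup (fun w => k (z - w) * F w) w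
  have hGB : G ≠ ∞ := ne_top_of_le_ne_top hB <| iSup_le fun w =>
    (mul_le_mul' (hk1 _) (hFB w)).trans_eq (one_mul B)
  have hGr : G ^ (1 - r) ≠ ∞ := ENNReal.rpow_ne_top_of_nonneg hr1' hGB
  set I := ∫⁻ w, (k (z - w) * F w) ^ r ∂μ
  have h1 : ∫⁻ w, k (z - w) * F w ∂μ ≤ G ^ (1 - r) * I := by
    rw [← lintegral_const_mul' _ _ hGr]
    refine lintegral_mono fun w => ?_
    calc k (z - w) * F w = (k (z - w) * F w) ^ (1 - r) * (k (z - w) * F w) ^ r := by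
          rw [← ENNReal.rpow_add_of_nonneg _ _ hr1' hr.le, sub_add_cancel, ENNReal.rpow_one]
      _ ≤ G ^ (1 - r) * (k (z - w) * F w) ^ r := by
          gcongr
          exact hGle w
  have h2 : G ≤ C * (G ^ (1 - r) * I) := by
    refine iSup_le fun w => ?_
    calc k (z - w) * F w ≤ k (z - w) * (C * ∫⁻ v, k (w - v) * F v ∂μ) := by
          gcongr
          exact hF w
      _ = C * ∫⁻ v, k (z - w) * (k (w - v) * F v) ∂μ := by
          rw [lintegral_const_mul' _ _ (ne_top_of_le_ne_top ENNReal.one_ne_top (hk1 _))]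
          ring
      _ ≤ C * ∫⁻ v, k (z - v) * F v ∂μ := by
          refine mul_le_mul_right (lintegral_mono fun v => ?_) C
          rw [← mul_assoc]
          refine mul_le_mul_left ?_ (F v)
          simpa using hk (z - w) (w - v)
      _ ≤ C * (G ^ (1 - r) * I) := by gcongr
  have h3 : G ^ r ≤ C * I := by
    rcases eq_or_ne G 0 with h0 | h0
    · rw [h0, ENNReal.zero_rpow_of_pos hr]
      exact zero_le
    · have hG0 : G ^ (1 - r) ≠ 0 := by simp [h0, hGB]
      rw [← ENNReal.mul_le_mul_iff_right hG0 hGr,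
        ← ENNReal.rpow_add_of_nonneg _ _ hr1' hr.le, sub_add_cancel, ENNReal.rpow_one]
      exact h2.trans_eq (mul_left_comm _ _ _)
  calc (∫⁻ w, k (z - w) * F w ∂μ) ^ r ≤ (G ^ (1 - r) * I) ^ r := by gcongr
    _ = (G ^ r) ^ (1 - r) * I ^ r := by
        rw [ENNReal.mul_rpow_of_nonneg _ _ hr.le, ← ENNReal.rpow_mul, ← ENNReal.rpow_mul,
          mul_comm r]
    _ ≤ (C * I) ^ (1 - r) * I ^ r := by gcongr
    _ = C ^ (1 - r) * I := by
        rw [ENNReal.mul_rpow_of_nonneg _ _ hr1', mul_assoc,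
          ← ENNReal.rpow_add_of_nonneg _ _ hr1' hr.le, sub_add_cancel, ENNReal.rpow_one]

end ReverseHolder

section MixedNorms

variable {X Y : Type*} [MeasurableSpace X] [MeasurableSpace Y]

theorem eLp_top (μ : Measure X) (f : X → ℝ≥0∞) : eLp ∞ μ f = essSup f μ := if_pos rfl

theorem eLp_of_ne_top {p : ℝ≥0∞} (hp : p ≠ ∞) (μ : Measure X) (f : X → ℝ≥0∞) :
    eLp p μ f = (∫⁻ a, f a ^ p.toReal ∂μ) ^ (1 / p.toReal) := if_neg hp

theorem eLp_mono {p : ℝ≥0∞} {μ : Measure X} {f g : X → ℝ≥0∞} (h : ∀ x, f x ≤ g x) :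
    eLp p μ f ≤ eLp p μ g := by
  unfold eLp
  split_ifs
  · exact essSup_mono_ae (.of_forall h)
  · gcongr with x
    exact h x

theorem eLp_const_mul {p : ℝ≥0∞} (hp : p ≠ 0) {μ : Measure X} {c : ℝ≥0∞} (hc : c ≠ ∞)
    (f : X → ℝ≥0∞) : eLp p μ (fun x => c * f x) = c * eLp p μ f := by
  unfold eLp
  split_ifs with h
  · exact ENNReal.essSup_const_mul
  · have hp' : 0 < p.toReal := ENNReal.toReal_pos hp h
    simp_rw [ENNReal.mul_rpow_of_nonneg _ _ hp'.le]
    rw [lintegral_const_mul' _ _ (ENNReal.rpow_ne_top_of_nonneg hp'.le hc),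
      ENNReal.mul_rpow_of_nonneg _ _ (by positivity), ← ENNReal.rpow_mul,
      mul_one_div_cancel hp'.ne', ENNReal.rpow_one]

theorem eLp_rpow {p : ℝ≥0∞} {r : ℝ} (hr : 0 < r) (μ : Measure X) (f : X → ℝ≥0∞) :
    eLp p μ f ^ r = eLp (p / ENNReal.ofReal r) μ (fun x => f x ^ r) := by
  have hr0 : ENNReal.ofReal r ≠ 0 := by simpa using hr
  rcases eq_or_ne p ∞ with rfl | hp
  · rw [ENNReal.top_div_of_ne_top ENNReal.ofReal_ne_top, eLp_top, eLp_top]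
    exact (ENNReal.orderIsoRpow r hr).essSup_apply f μ
  · rw [eLp_of_ne_top hp, eLp_of_ne_top (ENNReal.div_ne_top hp hr0), ENNReal.toReal_div,
      ENNReal.toReal_ofReal hr.le, ← ENNReal.rpow_mul]
    simp_rw [← ENNReal.rpow_mul]
    rw [mul_div_cancel₀ _ hr.ne', one_div_div, one_div_mul_eq_div]

theorem eLp_comp_sub {G : Type*} [AddCommGroup G] [MeasurableSpace G] [MeasurableAdd G]
    {μ : Measure G} [μ.IsAddRightInvariant] (p : ℝ≥0∞) (f : G → ℝ≥0∞) (c : G) :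
    eLp p μ (fun x => f (x - c)) = eLp p μ f := by
  unfold eLp
  split_ifs
  · have hmp : Measure.map (fun x => x - c) μ = μ := by
      simpa only [sub_eq_add_neg] using map_add_right_eq_self μ (-c)
    have he : MeasurableEmbedding (fun x : G => x - c) := by
      simpa only [sub_eq_add_neg] using measurableEmbedding_addRight (-c)
    have := he.essSup_map_measure (g := f) (μ := μ)
    rw [hmp] at this
    exact this.symm
  · rw [lintegral_sub_right_eq_self fun x => f x ^ p.toReal]

theorem measurable_eLp {μ : Measure X} [SFinite μ] {G : X → Y → ℝ≥0∞}
    (hG : Measurable (Function.uncurry G)) (p : ℝ≥0∞) :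
    Measurable fun y => eLp p μ fun x => G x y := by
  rcases eq_or_ne p ∞ with rfl | hp
  · refine measurable_of_Iic fun a => ?_
    have hm : MeasurableSet (Function.uncurry G ⁻¹' Set.Ioi a) := hG measurableSet_Ioi
    have h : (fun y => eLp ∞ μ fun x => G x y) ⁻¹' Set.Iic a =
        (fun y => μ ((fun x => (x, y)) ⁻¹' (Function.uncurry G ⁻¹' Set.Ioi a))) ⁻¹' {0} := by
      ext y
      simp only [eLp_top, Set.mem_preimage, Set.mem_Iic, Set.mem_singleton_iff]
      have hae : (∀ᵐ x ∂μ, G x y ≤ a) ↔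
          μ ((fun x => (x, y)) ⁻¹' (Function.uncurry G ⁻¹' Set.Ioi a)) = 0 := by
        rw [ae_iff]
        simp only [not_le]
        rfl
      rw [← hae]
      exact ⟨fun h => (ENNReal.ae_le_essSup _).mono fun x hx => hx.trans h,
        fun h => essSup_le_of_ae_le _ h⟩
    rw [h]
    exact measurable_measure_prodMk_right hm (measurableSet_singleton 0)
  · simp_rw [eLp_of_ne_top hp]
    exact ((hG.pow_const _).lintegral_prod_left').pow_const _

theorem lintegral_lintegral_rpow_le {μ : Measure X} {ν : Measure Y} [SigmaFinite μ] [SFinite ν]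
    {G : X → Y → ℝ≥0∞} (hG : Measurable (Function.uncurry G)) {p : ℝ} (hp : 1 ≤ p) :
    ∫⁻ x, (∫⁻ y, G x y ∂ν) ^ p ∂μ ≤ (∫⁻ y, (∫⁻ x, G x y ^ p ∂μ) ^ (1 / p) ∂ν) ^ p := by
  have hp0 : 0 < p := one_pos.trans_le hp
  have hp1 : 0 ≤ 1 - 1 / p := sub_nonneg.2 ((div_le_one hp0).2 hp)
  refine le_of_forall_lt fun L hL => ?_
  rw [lintegral_eq_nnreal] at hL
  simp_rw [lt_iSup_iff] at hL
  obtain ⟨φ, hφ, hLφ⟩ := hL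
  rw [← SimpleFunc.lintegral_eq_lintegral] at hLφ
  obtain ⟨g, hgφ, hgt, hLg⟩ := SimpleFunc.exists_lt_lintegral_simpleFunc_of_lt_lintegral
    (f := φ) (μ := μ) hLφ
  have hg : ∀ x, (g x : ℝ≥0∞) ≤ (∫⁻ y, G x y ∂ν) ^ p := fun x =>
    (ENNReal.coe_le_coe.2 (hgφ x)).trans (hφ x)
  have hgm : Measurable fun x => (g x : ℝ≥0∞) := g.measurable.coe_nnreal_ennreal
  refine hLg.trans_le ?_
  set T := ∫⁻ x, (g x : ℝ≥0∞) ∂μ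
  set A := ∫⁻ y, (∫⁻ x, G x y ^ p ∂μ) ^ (1 / p) ∂ν
  have hTt : T ^ (1 - 1 / p) ≠ ∞ := ENNReal.rpow_ne_top_of_nonneg hp1 hgt.ne
  have key : T ≤ A * T ^ (1 - 1 / p) := by
    calc T ≤ ∫⁻ x, (∫⁻ y, G x y ∂ν) * (g x : ℝ≥0∞) ^ (1 - 1 / p) ∂μ := by
          refine lintegral_mono fun x => ?_
          calc (g x : ℝ≥0∞) = (g x : ℝ≥0∞) ^ (1 / p) * (g x : ℝ≥0∞) ^ (1 - 1 / p) := by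
                rw [← ENNReal.rpow_add_of_nonneg _ _ (by positivity) hp1, add_sub_cancel,
                  ENNReal.rpow_one]
            _ ≤ ((∫⁻ y, G x y ∂ν) ^ p) ^ (1 / p) * (g x : ℝ≥0∞) ^ (1 - 1 / p) := by
                gcongr
                exact hg x
            _ = _ := by rw [← ENNReal.rpow_mul, mul_one_div_cancel hp0.ne', ENNReal.rpow_one]
      _ = ∫⁻ x, ∫⁻ y, G x y * (g x : ℝ≥0∞) ^ (1 - 1 / p) ∂ν ∂μ := by
          refine lintegral_congr fun x => (lintegral_mul_const' _ _ ?_).symm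
          exact ENNReal.rpow_ne_top_of_nonneg hp1 ENNReal.coe_ne_top
      _ = ∫⁻ y, ∫⁻ x, G x y * (g x : ℝ≥0∞) ^ (1 - 1 / p) ∂μ ∂ν :=
          lintegral_lintegral_swap (hG.mul ((hgm.comp measurable_fst).pow_const _)).aemeasurable
      _ ≤ ∫⁻ y, (∫⁻ x, G x y ^ p ∂μ) ^ (1 / p) * T ^ (1 - 1 / p) ∂ν := by
          refine lintegral_mono fun y => ?_
          have h := ENNReal.lintegral_mul_norm_pow_le (μ := μ) (f := fun x => G x y ^ p)
            ((hG.comp (measurable_id.prodMk measurable_const)).pow_const p).aemeasurable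
            hgm.aemeasurable (p := 1 / p) (by positivity) hp1 (add_sub_cancel _ _)
          simpa only [← ENNReal.rpow_mul, mul_one_div_cancel hp0.ne', ENNReal.rpow_one] using h
      _ = A * T ^ (1 - 1 / p) := lintegral_mul_const' _ _ hTt
  have h1 : T ^ (1 / p) ≤ A := by
    rcases eq_or_ne T 0 with h0 | h0
    · rw [h0, ENNReal.zero_rpow_of_pos (by positivity)]
      exact zero_le
    · have hT0 : T ^ (1 - 1 / p) ≠ 0 := by simp [h0, hgt.ne]
      rw [← ENNReal.mul_le_mul_iff_left hT0 hTt,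
        ← ENNReal.rpow_add_of_nonneg _ _ (by positivity) hp1, add_sub_cancel, ENNReal.rpow_one]
      exact key
  calc T = (T ^ (1 / p)) ^ p := by
        rw [← ENNReal.rpow_mul, one_div_mul_cancel hp0.ne', ENNReal.rpow_one]
    _ ≤ A ^ p := by gcongr

/-- Minkowski's integral inequality. -/
theorem eLp_lintegral_le {μ : Measure X} {ν : Measure Y} [SigmaFinite μ] [SFinite ν]
    {G : X → Y → ℝ≥0∞} (hG : Measurable (Function.uncurry G)) {p : ℝ≥0∞} (hp : 1 ≤ p) :
    eLp p μ (fun x => ∫⁻ y, G x y ∂ν) ≤ ∫⁻ y, eLp p μ (fun x => G x y) ∂ν := by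
  rcases eq_or_ne p ∞ with rfl | hpt
  · have hS := measurable_eLp (μ := μ) hG ∞
    rw [eLp_top]
    refine essSup_le_of_ae_le _ ?_
    have h : ∀ᵐ x ∂μ, ∀ᵐ y ∂ν, G x y ≤ eLp ∞ μ fun x => G x y := by
      refine (Measure.ae_ae_comm (p := fun x y => G x y ≤ eLp ∞ μ fun x => G x y)
        (measurableSet_le hG (hS.comp measurable_snd))).2 (.of_forall fun y => ?_)
      rw [eLp_top]
      exact ENNReal.ae_le_essSup _
    filter_upwards [h] with x hx
    exact lintegral_mono_ae hx
  · have hp' : 1 ≤ p.toReal := by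
      rw [← ENNReal.toReal_one]
      exact ENNReal.toReal_mono hpt hp
    have hp0 : 0 < p.toReal := one_pos.trans_le hp'
    simp_rw [eLp_of_ne_top hpt]
    calc _ ≤ ((∫⁻ y, (∫⁻ x, G x y ^ p.toReal ∂μ) ^ (1 / p.toReal) ∂ν) ^ p.toReal) ^
          (1 / p.toReal) := by
          gcongr
          exact lintegral_lintegral_rpow_le hG hp'
      _ = _ := by rw [← ENNReal.rpow_mul, mul_one_div_cancel hp0.ne', ENNReal.rpow_one]

end MixedNorms

section MixedConvolution

/-- Young's inequality `L¹ * L^{p,q} ⊆ L^{p,q}` for mixed norms. -/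
theorem eLp_eLp_convolution_le {G : Type*} [AddCommGroup G] [MeasurableSpace G] [MeasurableAdd₂ G]
    [MeasurableSub₂ G] {μ : Measure G} [SigmaFinite μ] [μ.IsAddRightInvariant]
    {κ f : G × G → ℝ≥0∞} (hκ : Measurable κ) (hκt : ∀ z, κ z ≠ ∞) (hf : Measurable f)
    {p q : ℝ≥0∞} (hp : 1 ≤ p) (hq : 1 ≤ q) :
    eLp q μ (fun ξ => eLp p μ fun x => ∫⁻ w, κ w * f ((x, ξ) - w) ∂μ.prod μ) ≤
      (∫⁻ w, κ w ∂μ.prod μ) * eLp q μ fun ξ => eLp p μ fun x => f (x, ξ) := by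
  have hp0 : p ≠ 0 := (one_pos.trans_le hp).ne'
  have hq0 : q ≠ 0 := (one_pos.trans_le hq).ne'
  set N : G → ℝ≥0∞ := fun ξ => eLp p μ fun x => f (x, ξ)
  have hN : Measurable N := measurable_eLp (G := fun x ξ => f (x, ξ)) hf p
  have hx : ∀ ξ (w : G × G), eLp p μ (fun x => κ w * f ((x, ξ) - w)) = κ w * N (ξ - w.2) :=
    fun ξ w => by
      rw [eLp_const_mul hp0 (hκt w)]
      exact congrArg _ (eLp_comp_sub p (fun x => f (x, ξ - w.2)) w.1)
  calc _ ≤ eLp q μ fun ξ => ∫⁻ w, κ w * N (ξ - w.2) ∂μ.prod μ := by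
        refine eLp_mono fun ξ => (eLp_lintegral_le ?_ hp).trans_eq (by simp_rw [hx])
        exact (hκ.comp measurable_snd).mul
          (hf.comp ((measurable_fst.sub (measurable_fst.comp measurable_snd)).prodMk
            (measurable_const.sub (measurable_snd.comp measurable_snd))))
    _ ≤ ∫⁻ w, eLp q μ (fun ξ => κ w * N (ξ - w.2)) ∂μ.prod μ := by
        refine eLp_lintegral_le ?_ hq
        exact (hκ.comp measurable_snd).mul
          (hN.comp (measurable_fst.sub (measurable_snd.comp measurable_snd)))
    _ = ∫⁻ w, κ w * eLp q μ N ∂μ.prod μ := by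
        refine lintegral_congr fun w => ?_
        rw [eLp_const_mul hq0 (hκt w), eLp_comp_sub q N w.2]
    _ = _ := lintegral_mul_const _ hκ

end MixedConvolution

section Boundedness

variable {n : ℕ}

/-- Pointwise control of the short-time Fourier transform of `a(x,D)u` by an `r`-th power
convolution, for `0 < r ≤ 1`. -/
theorem SigmaClass.exists_STFT_KNQuant_rpow_le {k l : ℕ} {m : ℝ}
    {a : (EuclideanSpace ℝ (Fin n) × EuclideanSpace ℝ (Fin n)) → ℂ}
    (ha : SigmaClass n k l (-m) a) {s : ℝ} (hs : 0 ≤ s) {r : ℝ} (hr : 0 < r) (hr1 : r ≤ 1) :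
    ∃ K : ℝ≥0∞, K ≠ ∞ ∧ ∀ (u : SchwartzMap (EuclideanSpace ℝ (Fin n)) ℂ) z,
      ENNReal.ofReal (‖STFT n (KNQuant n a u) z.1 z.2‖ * anharmonicWeight k l z ^ m) ^ r ≤
        K * ∫⁻ w : EuclideanSpace ℝ (Fin n) × EuclideanSpace ℝ (Fin n),
          ENNReal.ofReal (phaseWeight w ^ (-s)) ^ r *
            ‖STFT n u (z - w).1 (z - w).2‖ₑ ^ r := by
  have : (volume : Measure (EuclideanSpace ℝ (Fin n) × EuclideanSpace ℝ (Fin n))).IsNegInvariant :=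
    Measure.IsAddHaarMeasure.isNegInvariant_of_regular _
  obtain ⟨A, -, hA⟩ := ha.exists_STFT_KNQuant_le hs
  obtain ⟨B, -, hB⟩ := exists_enorm_STFT_le (n := n) hs
  refine ⟨ENNReal.ofReal A ^ r * ENNReal.ofReal B ^ (1 - r), ENNReal.mul_ne_top
    (ENNReal.rpow_ne_top_of_nonneg hr.le ENNReal.ofReal_ne_top)
    (ENNReal.rpow_ne_top_of_nonneg (sub_nonneg.2 hr1) ENNReal.ofReal_ne_top), fun u z => ?_⟩
  obtain ⟨M, -, hM⟩ := exists_norm_STFT_le u le_rfl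
  have hFM : ∀ w : EuclideanSpace ℝ (Fin n) × EuclideanSpace ℝ (Fin n),
      ‖STFT n u w.1 w.2‖ₑ ≤ ENNReal.ofReal M := fun w => by
    rw [← ofReal_norm]
    exact ENNReal.ofReal_le_ofReal (by simpa using hM w)
  have key := lintegral_mul_rpow_le_of_le_lintegral (μ := volume)
    (k := fun w : EuclideanSpace ℝ (Fin n) × EuclideanSpace ℝ (Fin n) =>
      ENNReal.ofReal (phaseWeight w ^ (-s)))
    (fun w => ENNReal.ofReal_le_one.2 (phaseWeight_rpow_le_one hs w))
    (fun w w' => by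
      rw [← ENNReal.ofReal_mul (Real.rpow_nonneg (phaseWeight_pos w).le _)]
      exact ENNReal.ofReal_le_ofReal (phaseWeight_rpow_mul_le hs w w'))
    ENNReal.ofReal_ne_top hFM (hB u) hr hr1 z
  calc _ ≤ (ENNReal.ofReal A * _) ^ r := ENNReal.rpow_le_rpow (hA u z) hr.le
    _ ≤ _ := by
      rw [ENNReal.mul_rpow_of_nonneg _ _ hr.le, mul_assoc]
      refine mul_le_mul_right (key.trans_eq ?_) _
      rw [← lintegral_sub_left_eq_self _ z]
      simp_rw [sub_sub_cancel, ENNReal.mul_rpow_of_nonneg _ _ hr.le]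

theorem exists_rpow_exponent {p q : ℝ≥0∞} (hp : 0 < p) (hq : 0 < q) :
    ∃ r : ℝ, 0 < r ∧ r ≤ 1 ∧ 1 ≤ p / ENNReal.ofReal r ∧ 1 ≤ q / ENNReal.ofReal r := by
  have h1 : min 1 (min p q) ≠ ∞ := ne_top_of_le_ne_top ENNReal.one_ne_top (min_le_left _ _)
  have h0 : min 1 (min p q) ≠ 0 := (lt_min one_pos (lt_min hp hq)).ne'
  refine ⟨(min 1 (min p q)).toReal, ENNReal.toReal_pos h0 h1,
    ENNReal.toReal_le_of_le_ofReal zero_le_one (by simp), ?_⟩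
  rw [ENNReal.ofReal_toReal h1, ENNReal.le_div_iff_mul_le (.inl h0) (.inl h1),
    ENNReal.le_div_iff_mul_le (.inl h0) (.inl h1), one_mul]
  simp

theorem modNorm_rpow {p q : ℝ≥0∞} {r : ℝ} (hr : 0 < r)
    (w : EuclideanSpace ℝ (Fin n) → EuclideanSpace ℝ (Fin n) → ℝ)
    (f : EuclideanSpace ℝ (Fin n) → ℂ) :
    modNorm n p q w f ^ r = eLp (q / ENNReal.ofReal r) volume fun ξ =>
      eLp (p / ENNReal.ofReal r) volume fun x => ENNReal.ofReal (‖STFT n f x ξ‖ * w x ξ) ^ r := by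
  rw [modNorm, eLp_rpow hr]
  simp_rw [eLp_rpow hr]

end Boundedness

/-- If `a ∈ Σ^{-m}_{k,ℓ}` then the Kohn–Nirenberg quantization `a(x,D)` is bounded from
`M^{p,q}` to `M^{p,q}_{v^m}` with `v(x,ξ) = 1+|x|^k+|ξ|^ℓ`, for every `0 < p,q ≤ ∞`. -/
theorem kn_quantization_modulation_bounded (k l n : ℕ) (m : ℝ) (hk : 1 ≤ k) (hl : 1 ≤ l)
    (hn : 1 ≤ n) (p q : ℝ≥0∞) (hp : 0 < p) (hq : 0 < q)
    (a : (EuclideanSpace ℝ (Fin n) × EuclideanSpace ℝ (Fin n)) → ℂ)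
    (ha : SigmaClass n k l (-m) a) :
    ∃ C : ℝ, 0 < C ∧ ∀ u : SchwartzMap (EuclideanSpace ℝ (Fin n)) ℂ,
      modNorm n p q (fun x ξ => (1 + ‖x‖ ^ k + ‖ξ‖ ^ l) ^ m) (KNQuant n a u) ≤
        ENNReal.ofReal C * modNorm n p q (fun _ _ => 1) u := by
  obtain ⟨r, hr, hr1, hpr, hqr⟩ := exists_rpow_exponent hp hq
  set d : ℝ := Module.finrank ℝ (EuclideanSpace ℝ (Fin n)) + 1 with hd
  have hd0 : 0 < d := by positivity
  obtain ⟨K, hK, hKle⟩ := ha.exists_STFT_KNQuant_rpow_le (div_pos hd0 hr).le hr hr1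
  set κ : EuclideanSpace ℝ (Fin n) × EuclideanSpace ℝ (Fin n) → ℝ≥0∞ := fun w =>
    ENNReal.ofReal (phaseWeight w ^ (-(d / r))) ^ r with hκ
  have hκm : Measurable κ :=
    ((continuous_phaseWeight_rpow _).measurable.ennreal_ofReal).pow_const r
  have hκt : ∀ w, κ w ≠ ∞ := fun w => ENNReal.rpow_ne_top_of_nonneg hr.le ENNReal.ofReal_ne_top
  have hκi : ∫⁻ w, κ w ≠ ∞ := by
    have h : ∀ w, κ w = ENNReal.ofReal (phaseWeight w ^ (-d)) := fun w => by
      have hw := (phaseWeight_pos w).le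
      rw [hκ]
      dsimp only
      rw [ENNReal.ofReal_rpow_of_nonneg (Real.rpow_nonneg hw _) hr.le, ← Real.rpow_mul hw,
        neg_mul, div_mul_cancel₀ _ hr.ne']
    simp_rw [h]
    exact (integrable_phaseWeight_rpow (lt_add_one _)).lintegral_lt_top.ne
  set L : ℝ≥0∞ := (K * ∫⁻ w, κ w) ^ (1 / r)
  have hL : L ≠ ∞ := ENNReal.rpow_ne_top_of_nonneg (by positivity) (ENNReal.mul_ne_top hK hκi)
  refine ⟨L.toReal + 1, by positivity, fun u => ?_⟩
  have hH : ∀ x ξ, ENNReal.ofReal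
      (‖STFT n (KNQuant n a u) x ξ‖ * (1 + ‖x‖ ^ k + ‖ξ‖ ^ l) ^ m) ^ r ≤
        K * ∫⁻ w, κ w * ‖STFT n u ((x, ξ) - w).1 ((x, ξ) - w).2‖ₑ ^ r :=
    fun x ξ => hKle u (x, ξ)
  have key : modNorm n p q (fun x ξ => (1 + ‖x‖ ^ k + ‖ξ‖ ^ l) ^ m) (KNQuant n a u) ^ r ≤
      (K * ∫⁻ w, κ w) * modNorm n p q (fun _ _ => 1) u ^ r := by
    rw [modNorm_rpow hr, modNorm_rpow hr, mul_assoc]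
    simp_rw [mul_one, ofReal_norm]
    refine (eLp_mono fun ξ => (eLp_mono fun x => hH x ξ).trans_eq
      (eLp_const_mul (one_pos.trans_le hpr).ne' hK _)).trans ?_
    rw [eLp_const_mul (one_pos.trans_le hqr).ne' hK]
    gcongr
    exact eLp_eLp_convolution_le hκm hκt
      ((continuous_STFT u).measurable.enorm.pow_const r) hpr hqr
  have hL1 : L ≤ ENNReal.ofReal (L.toReal + 1) :=
    ENNReal.le_ofReal_iff_toReal_le hL (by positivity) |>.2 (by linarith)
  calc modNorm n p q (fun x ξ => (1 + ‖x‖ ^ k + ‖ξ‖ ^ l) ^ m) (KNQuant n a u)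
      = (modNorm n p q (fun x ξ => (1 + ‖x‖ ^ k + ‖ξ‖ ^ l) ^ m) (KNQuant n a u) ^ r) ^ (1 / r) := by
        rw [← ENNReal.rpow_mul, mul_one_div_cancel hr.ne', ENNReal.rpow_one]
    _ ≤ ((K * ∫⁻ w, κ w) * modNorm n p q (fun _ _ => 1) u ^ r) ^ (1 / r) := by gcongr
    _ = L * modNorm n p q (fun _ _ => 1) u := by
        rw [ENNReal.mul_rpow_of_nonneg _ _ (by positivity), ← ENNReal.rpow_mul,
          mul_one_div_cancel hr.ne', ENNReal.rpow_one]
    _ ≤ _ := by gcongr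
end
end
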